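/- arXiv:1703.06830 — 4 statements merged into one kernel-verified Lean document; each statement's English description precedes it below -/
import Mathlib

section
/- (L^p-contractivity of the one-dimensional generalized translation.) Let λ > −1/2, 1 ≤ p ≤ ∞ and t ∈ ℝ. For every Schwartz function f on ℝ one has ‖T^t f‖_{L^p(ℝ,dμ)} ≤ ‖f‖_{L^p(ℝ,dμ)}, i.e., ∫_ℝ |T^t f(x)|^p |x|^{2λ+1} dx ≤ ∫_ℝ |f(x)|^p |x|^{2λ+1} dx for p < ∞, and sup_x |T^t f(x)| ≤ sup_x |f(x)| for p = ∞. -/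
open MeasureTheory Real
open scoped NNReal ENNReal

noncomputable section

namespace Dunkl1DStmt10

/-- `b_λ = (2^λ Γ(λ+1))⁻¹`. -/
def blam (lam : ℝ) : ℝ := ((2 : ℝ) ^ lam * Real.Gamma (lam + 1))⁻¹

/-- `c_λ = Γ(λ+1)/(√π Γ(λ+1/2))`. -/
def clam (lam : ℝ) : ℝ := Real.Gamma (lam + 1) / (Real.sqrt Real.pi * Real.Gamma (lam + 1/2))

/-- The measure `dμ(x) = (b_λ/2)|x|^{2λ+1} dx` on `ℝ`. -/
def μw (lam : ℝ) : Measure ℝ :=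
  volume.withDensity fun x => ENNReal.ofReal (blam lam / 2 * |x| ^ (2 * lam + 1))

/-- The measure `dν_λ(t) = b_λ t^{2λ+1} dt` on `(0,∞)`. -/
def νw (lam : ℝ) : Measure ℝ :=
  (volume.restrict (Set.Ioi 0)).withDensity fun t => ENNReal.ofReal (blam lam * t ^ (2 * lam + 1))

/-- The one-dimensional Dunkl-type generalized translation operator
`T^t f(x) = (c_λ/2) ∫_0^π [f(A)(1+B) + f(−A)(1−B)] sin^{2λ}φ dφ`,
`A = √(x² + t² − 2xt cos φ)`, `B = (x − t cos φ)/A` (with `B = 0` when `A = 0`, which is Lean's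
division convention). -/
def T (lam t : ℝ) (f : ℝ → ℂ) (x : ℝ) : ℂ :=
  ((clam lam / 2 : ℝ) : ℂ) *
    ∫ φ in Set.Ioo (0 : ℝ) Real.pi,
      ((f (Real.sqrt (x ^ 2 + t ^ 2 - 2 * x * t * Real.cos φ)) *
          (1 + (((x - t * Real.cos φ) /
            Real.sqrt (x ^ 2 + t ^ 2 - 2 * x * t * Real.cos φ) : ℝ) : ℂ)) +
        f (-Real.sqrt (x ^ 2 + t ^ 2 - 2 * x * t * Real.cos φ)) *
          (1 - (((x - t * Real.cos φ) /
            Real.sqrt (x ^ 2 + t ^ 2 - 2 * x * t * Real.cos φ) : ℝ) : ℂ))) *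
        ((Real.sin φ ^ (2 * lam) : ℝ) : ℂ))

open Set

theorem polar_lem (G : ℝ → ℝ≥0∞) (hG : Measurable G) (lam t : ℝ) :
    ∫⁻ x in Ioi (0:ℝ), ∫⁻ φ in Ioo (0:ℝ) π,
      G (√(x ^ 2 + t ^ 2 - 2 * x * t * cos φ)) * ENNReal.ofReal (x ^ (2 * lam + 1) * sin φ ^ (2 * lam))
    = ∫⁻ u : ℝ, ∫⁻ v in Ioi (0:ℝ), G (√((u - t) ^ 2 + v ^ 2)) * ENNReal.ofReal (v ^ (2 * lam)) := by
  set Q : ℝ × ℝ → ℝ≥0∞ := fun q => (Ioi (0:ℝ)).indicator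
    (fun v => G (√((q.1 - t) ^ 2 + v ^ 2)) * ENNReal.ofReal (v ^ (2 * lam))) q.2 with hQ
  have hQm : Measurable Q := by
    have : Q = (Prod.snd ⁻¹' (Ioi (0:ℝ))).indicator
      (fun q : ℝ × ℝ => G (√((q.1 - t) ^ 2 + q.2 ^ 2)) * ENNReal.ofReal (q.2 ^ (2 * lam))) := by
      ext q; simp [hQ, indicator]
    rw [this]
    apply Measurable.indicator
    · fun_prop
    · exact measurable_snd measurableSet_Ioi
  have h1 := lintegral_comp_polarCoord_symm Q
  have h2 : ∫⁻ q, Q q = ∫⁻ u : ℝ, ∫⁻ v in Ioi (0:ℝ),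
      G (√((u - t) ^ 2 + v ^ 2)) * ENNReal.ofReal (v ^ (2 * lam)) := by
    rw [Measure.volume_eq_prod, lintegral_prod _ hQm.aemeasurable]
    refine lintegral_congr fun u => ?_
    rw [← lintegral_indicator measurableSet_Ioi]
  rw [← h2, ← h1, polarCoord_target, Measure.volume_eq_prod, ← Measure.prod_restrict, lintegral_prod]
  · refine setLIntegral_congr_fun measurableSet_Ioi fun x hx => ?_
    have hx : 0 < x := hx
    have hsub : Ioo (0:ℝ) π ⊆ Ioo (-π) π := Ioo_subset_Ioo_left (by linarith [pi_pos])
    rw [← lintegral_indicator measurableSet_Ioo, ← lintegral_indicator measurableSet_Ioo]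
    refine lintegral_congr fun φ => ?_
    by_cases hφ : φ ∈ Ioo (0:ℝ) π
    · have hs : 0 < sin φ := sin_pos_of_mem_Ioo hφ
      have hv : x * sin φ ∈ Ioi (0:ℝ) := mul_pos hx hs
      rw [indicator_of_mem hφ, indicator_of_mem (hsub hφ)]
      simp only [hQ, polarCoord_symm_apply, indicator_of_mem hv, smul_eq_mul]
      have e : (x * cos φ - t) ^ 2 + (x * sin φ) ^ 2 = x ^ 2 + t ^ 2 - 2 * x * t * cos φ := by
        have := sin_sq_add_cos_sq φ
        linear_combination x ^ 2 * this
      rw [e, mul_left_comm, ← ENNReal.ofReal_mul hx.le, mul_rpow hx.le hs.le, rpow_add hx, rpow_one]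
      congr 2
      ring
    · rw [indicator_of_notMem hφ]
      by_cases hφ2 : φ ∈ Ioo (-π) π
      · have hs : sin φ ≤ 0 := by
          apply sin_nonpos_of_nonpos_of_neg_pi_le _ hφ2.1.le
          by_contra h
          exact hφ ⟨not_le.1 h, hφ2.2⟩
        have hv : x * sin φ ∉ Ioi (0:ℝ) := by
          simpa using mul_nonpos_of_nonneg_of_nonpos hx.le hs
        rw [indicator_of_mem hφ2]
        simp only [hQ, polarCoord_symm_apply, indicator_of_notMem hv, smul_zero]
      · rw [indicator_of_notMem hφ2]
  · have : Measurable (fun p : ℝ × ℝ => polarCoord.symm p) := by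
      simp only [polarCoord_symm_apply]; fun_prop
    simp only [smul_eq_mul]
    exact ((measurable_fst.ennreal_ofReal).mul (hQm.comp this)).aemeasurable


theorem polar_zero (G : ℝ → ℝ≥0∞) (hG : Measurable G) (lam : ℝ) :
    (∫⁻ x in Ioi (0:ℝ), G x * ENNReal.ofReal (x ^ (2 * lam + 1))) *
      (∫⁻ φ in Ioo (0:ℝ) π, ENNReal.ofReal (sin φ ^ (2 * lam)))
    = ∫⁻ u : ℝ, ∫⁻ v in Ioi (0:ℝ), G (√(u ^ 2 + v ^ 2)) * ENNReal.ofReal (v ^ (2 * lam)) := by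
  have h := polar_lem G hG lam 0
  simp only [sub_zero] at h
  rw [← h, ← lintegral_mul_const]
  · refine setLIntegral_congr_fun measurableSet_Ioi fun x hx => ?_
    have hx : 0 < x := hx
    rw [← lintegral_const_mul _ (by fun_prop)]
    refine setLIntegral_congr_fun measurableSet_Ioo fun φ hφ => ?_
    rw [ENNReal.ofReal_mul (by positivity), ← mul_assoc]
    simp [sqrt_sq hx.le]
  · fun_prop

theorem shift_lem (G : ℝ → ℝ≥0∞) (hG : Measurable G) (lam t : ℝ) :
    ∫⁻ x in Ioi (0:ℝ), ∫⁻ φ in Ioo (0:ℝ) π,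
      G (√(x ^ 2 + t ^ 2 - 2 * x * t * cos φ)) * ENNReal.ofReal (x ^ (2 * lam + 1) * sin φ ^ (2 * lam))
    = (∫⁻ x in Ioi (0:ℝ), G x * ENNReal.ofReal (x ^ (2 * lam + 1))) *
      (∫⁻ φ in Ioo (0:ℝ) π, ENNReal.ofReal (sin φ ^ (2 * lam))) := by
  rw [polar_lem G hG, polar_zero G hG]
  exact lintegral_sub_right_eq_self (fun u : ℝ => ∫⁻ v in Ioi (0:ℝ),
    G (√(u ^ 2 + v ^ 2)) * ENNReal.ofReal (v ^ (2 * lam))) t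

theorem gauss_half (q : ℝ) (hq : -1 < q) :
    ∫⁻ x in Ioi (0:ℝ), ENNReal.ofReal (exp (-x ^ 2)) * ENNReal.ofReal (x ^ q)
      = ENNReal.ofReal (1 / 2 * Gamma ((q + 1) / 2)) := by
  have h := integral_rpow_mul_exp_neg_rpow (p := 2) two_pos hq
  have hi := integrableOn_rpow_mul_exp_neg_mul_sq (b := 1) one_pos hq
  simp only [rpow_two] at h
  simp only [neg_mul, one_mul] at hi
  rw [← h, ofReal_integral_eq_lintegral_ofReal hi]
  · refine setLIntegral_congr_fun measurableSet_Ioi fun x hx => ?_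
    rw [← ENNReal.ofReal_mul (exp_pos _).le, mul_comm]
  · filter_upwards [ae_restrict_mem measurableSet_Ioi] with x hx
    have : 0 < x := hx
    simp only [Pi.zero_apply]
    positivity

theorem gauss_full :
    ∫⁻ x : ℝ, ENNReal.ofReal (exp (-x ^ 2)) = ENNReal.ofReal (√π) := by
  have h := integral_gaussian 1
  have hi := integrable_exp_neg_mul_sq (b := 1) one_pos
  simp only [neg_mul, one_mul, div_one] at h hi
  rw [← h, ofReal_integral_eq_lintegral_ofReal hi]
  filter_upwards with x
  simp only [Pi.zero_apply]
  positivity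

theorem sin_lem (lam : ℝ) (hlam : -(1/2 : ℝ) < lam) :
    ENNReal.ofReal (clam lam) * ∫⁻ φ in Ioo (0:ℝ) π, ENNReal.ofReal (sin φ ^ (2 * lam)) = 1 := by
  have h := polar_zero (fun x => ENNReal.ofReal (exp (-x ^ 2))) (by fun_prop) lam
  have e : ∀ u : ℝ, ∫⁻ v in Ioi (0:ℝ), ENNReal.ofReal (exp (-√(u ^ 2 + v ^ 2) ^ 2)) *
      ENNReal.ofReal (v ^ (2 * lam)) = ENNReal.ofReal (exp (-u ^ 2)) *
        ENNReal.ofReal (1 / 2 * Gamma ((2 * lam + 1) / 2)) := by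
    intro u
    rw [← gauss_half _ (by linarith), ← lintegral_const_mul _ (by fun_prop)]
    refine lintegral_congr fun v => ?_
    rw [sq_sqrt (by positivity), neg_add, exp_add, ENNReal.ofReal_mul (exp_pos _).le, mul_assoc]
  simp only [e] at h
  rw [lintegral_mul_const _ (by fun_prop), gauss_full, gauss_half _ (by linarith),
    show (2 * lam + 1 + 1) / 2 = lam + 1 by ring, show (2 * lam + 1) / 2 = lam + 1 / 2 by ring] at h
  have g1 : 0 < Gamma (lam + 1) := Gamma_pos_of_pos (by linarith)
  have g2 : 0 < Gamma (lam + 1 / 2) := Gamma_pos_of_pos (by linarith)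
  have hpi : 0 < √π := sqrt_pos.2 pi_pos
  have hc : clam lam = (√π * (1 / 2 * Gamma (lam + 1 / 2)))⁻¹ * (1 / 2 * Gamma (lam + 1)) := by
    unfold clam; field_simp
  rw [hc, ENNReal.ofReal_mul (by positivity), mul_assoc, h, ← ENNReal.ofReal_mul (by positivity),
    ← ENNReal.ofReal_mul (by positivity), inv_mul_cancel₀ (by positivity), ENNReal.ofReal_one]

theorem split_lem (h : ℝ → ℝ≥0∞) (hm : Measurable h) :
    ∫⁻ x, h x = ∫⁻ x in Ioi (0:ℝ), (h x + h (-x)) := by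
  have e : ∫⁻ x in Iic (0:ℝ), h x = ∫⁻ x in Ioi (0:ℝ), h (-x) := by
    rw [← (Measure.measurePreserving_neg (volume : Measure ℝ)).setLIntegral_comp_preimage
      measurableSet_Iic hm]
    simp only [neg_preimage, neg_Iic, neg_zero]
    exact setLIntegral_congr Ioi_ae_eq_Ici.symm
  rw [← lintegral_add_compl h measurableSet_Ioi, compl_Ioi, e, lintegral_add_left hm]

theorem refl_lem (h : ℝ → ℝ≥0∞) (hm : Measurable h) :
    ∫⁻ φ in Ioo (0:ℝ) π, h φ = ∫⁻ φ in Ioo (0:ℝ) π, h (π - φ) := by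
  rw [← ((volume : Measure ℝ).measurePreserving_sub_left π).setLIntegral_comp_preimage
      measurableSet_Ioo hm]
  simp

def Av (t x φ : ℝ) : ℝ := √(x ^ 2 + t ^ 2 - 2 * x * t * cos φ)
def Bv (t x φ : ℝ) : ℝ := (x - t * cos φ) / Av t x φ

theorem Av_neg (t x φ : ℝ) : Av t (-x) (π - φ) = Av t x φ := by
  unfold Av; rw [cos_pi_sub]; congr 1; ring

theorem Bv_neg (t x φ : ℝ) : Bv t (-x) (π - φ) = -Bv t x φ := by
  unfold Bv; rw [Av_neg, cos_pi_sub]; ring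

theorem Bv_abs (t x φ : ℝ) : |Bv t x φ| ≤ 1 := by
  unfold Bv Av
  rw [abs_div, abs_of_nonneg (sqrt_nonneg _)]
  apply div_le_one_of_le₀ _ (sqrt_nonneg _)
  apply abs_le_sqrt
  have := sin_sq_add_cos_sq φ
  nlinarith [sq_nonneg (t * sin φ)]

/-- the positive kernel -/
def Kv (g : ℝ → ℝ≥0∞) (t x φ : ℝ) : ℝ≥0∞ :=
  ENNReal.ofReal ((1 + Bv t x φ) / 2) * g (Av t x φ) +
    ENNReal.ofReal ((1 - Bv t x φ) / 2) * g (-Av t x φ)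

theorem Bsum (t x φ : ℝ) :
    ENNReal.ofReal ((1 + Bv t x φ) / 2) + ENNReal.ofReal ((1 - Bv t x φ) / 2) = 1 := by
  have := abs_le.1 (Bv_abs t x φ)
  rw [← ENNReal.ofReal_add (by linarith) (by linarith)]
  ring_nf
  simp

theorem Kv_meas (g : ℝ → ℝ≥0∞) (hg : Measurable g) (t : ℝ) :
    Measurable (fun q : ℝ × ℝ => Kv g t q.1 q.2) := by
  unfold Kv Bv Av; fun_prop

theorem Kv_measx (g : ℝ → ℝ≥0∞) (hg : Measurable g) (t x : ℝ) : Measurable (Kv g t x) := by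
  unfold Kv Bv Av; fun_prop

theorem Kv_add (g : ℝ → ℝ≥0∞) (t x φ : ℝ) :
    Kv g t x φ + Kv g t (-x) (π - φ) = g (Av t x φ) + g (-Av t x φ) := by
  have := Bsum t x φ
  unfold Kv
  rw [Av_neg, Bv_neg, sub_neg_eq_add, ← sub_eq_add_neg]
  calc _ = (ENNReal.ofReal ((1 + Bv t x φ) / 2) + ENNReal.ofReal ((1 - Bv t x φ) / 2)) *
        (g (Av t x φ) + g (-Av t x φ)) := by ring
    _ = _ := by rw [this, one_mul]

/-- the angular probability measure -/
def mw (lam : ℝ) : Measure ℝ :=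
  (volume.restrict (Ioo (0:ℝ) π)).withDensity
    fun φ => ENNReal.ofReal (clam lam) * ENNReal.ofReal (sin φ ^ (2 * lam))

theorem mw_prob (lam : ℝ) (hlam : -(1/2 : ℝ) < lam) : IsProbabilityMeasure (mw lam) := by
  constructor
  rw [mw, withDensity_apply _ MeasurableSet.univ, Measure.restrict_univ,
    lintegral_const_mul _ (by fun_prop), sin_lem lam hlam]

theorem lint_mw (lam : ℝ) (h : ℝ → ℝ≥0∞) (hm : Measurable h) :
    ∫⁻ φ, h φ ∂(mw lam) = ENNReal.ofReal (clam lam) *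
      ∫⁻ φ in Ioo (0:ℝ) π, h φ * ENNReal.ofReal (sin φ ^ (2 * lam)) := by
  rw [mw, lintegral_withDensity_eq_lintegral_mul _ (by fun_prop) hm,
    ← lintegral_const_mul _ (by fun_prop)]
  refine lintegral_congr fun φ => ?_
  simp only [Pi.mul_apply]
  ring

theorem blam_pos (lam : ℝ) (hlam : -(1/2 : ℝ) < lam) : 0 < blam lam := by
  have g1 : 0 < Gamma (lam + 1) := Gamma_pos_of_pos (by linarith)
  unfold blam; positivity

theorem L1_lem (lam : ℝ) (hlam : -(1/2 : ℝ) < lam) (t : ℝ) (g : ℝ → ℝ≥0∞) (hg : Measurable g) :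
    ∫⁻ x, ∫⁻ φ, Kv g t x φ ∂(mw lam) ∂(μw lam) = ∫⁻ x, g x ∂(μw lam) := by
  have hb : 0 ≤ blam lam / 2 := (half_pos (blam_pos lam hlam)).le
  have := mw_prob lam hlam
  have hK := Kv_meas g hg t
  have hKx : ∀ x, Measurable (Kv g t x) := fun x => Kv_measx g hg t x
  have hI : Measurable (fun x => ∫⁻ φ, Kv g t x φ ∂(mw lam)) := hK.lintegral_prod_right'
  have hw : Measurable fun x : ℝ => ENNReal.ofReal (blam lam / 2 * |x| ^ (2 * lam + 1)) := by fun_prop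
  rw [μw, lintegral_withDensity_eq_lintegral_mul _ hw hI, lintegral_withDensity_eq_lintegral_mul _ hw hg,
    split_lem _ (hw.mul hI), split_lem _ (hw.mul hg)]
  simp only [Pi.mul_apply, abs_neg, ← mul_add]
  have e1 : ∀ x, ∫⁻ φ, Kv g t x φ ∂(mw lam) + ∫⁻ φ, Kv g t (-x) φ ∂(mw lam) =
      ENNReal.ofReal (clam lam) * ∫⁻ φ in Ioo (0:ℝ) π, (g (Av t x φ) + g (-Av t x φ)) *
        ENNReal.ofReal (sin φ ^ (2 * lam)) := by
    intro x
    have h1 := hKx x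
    have h2 := hKx (-x)
    rw [lint_mw _ _ h1, lint_mw _ _ h2, ← mul_add]
    rw [refl_lem (fun φ => Kv g t (-x) φ * ENNReal.ofReal (sin φ ^ (2 * lam))) (by fun_prop)]
    rw [← lintegral_add_left (by fun_prop)]
    congr 1
    refine lintegral_congr fun φ => ?_
    rw [sin_pi_sub, ← add_mul, Kv_add]
  simp only [e1]
  have hs := shift_lem (fun r => g r + g (-r)) (by fun_prop) lam t
  have e2 : ∀ x ∈ Ioi (0:ℝ), ENNReal.ofReal (blam lam / 2 * |x| ^ (2 * lam + 1)) *
      (ENNReal.ofReal (clam lam) * ∫⁻ φ in Ioo (0:ℝ) π, (g (Av t x φ) + g (-Av t x φ)) *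
        ENNReal.ofReal (sin φ ^ (2 * lam))) = 
      ENNReal.ofReal (blam lam / 2) * ENNReal.ofReal (clam lam) * ∫⁻ φ in Ioo (0:ℝ) π,
      (fun r => g r + g (-r)) (√(x ^ 2 + t ^ 2 - 2 * x * t * cos φ)) *
        ENNReal.ofReal (x ^ (2 * lam + 1) * sin φ ^ (2 * lam)) := by
    intro x hx
    have hx : 0 < x := hx
    rw [abs_of_pos hx, ENNReal.ofReal_mul hb]
    have : ∫⁻ φ in Ioo (0:ℝ) π,
      (fun r => g r + g (-r)) (√(x ^ 2 + t ^ 2 - 2 * x * t * cos φ)) *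
        ENNReal.ofReal (x ^ (2 * lam + 1) * sin φ ^ (2 * lam)) = ENNReal.ofReal (x ^ (2 * lam + 1)) *
        ∫⁻ φ in Ioo (0:ℝ) π, (g (Av t x φ) + g (-Av t x φ)) *
        ENNReal.ofReal (sin φ ^ (2 * lam)) := by
      rw [← lintegral_const_mul _ (by unfold Av; fun_prop)]
      refine lintegral_congr fun φ => ?_
      rw [ENNReal.ofReal_mul (by positivity)]
      simp only [Av]
      ring
    rw [this]
    ring
  have e3 : ∀ x ∈ Ioi (0:ℝ), ENNReal.ofReal (blam lam / 2 * |x| ^ (2 * lam + 1)) * (g x + g (-x)) =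
      ENNReal.ofReal (blam lam / 2) * ((g x + g (-x)) * ENNReal.ofReal (x ^ (2 * lam + 1))) := by
    intro x hx
    have hx : 0 < x := hx
    rw [abs_of_pos hx, ENNReal.ofReal_mul hb]
    ring
  rw [setLIntegral_congr_fun measurableSet_Ioi e2, setLIntegral_congr_fun measurableSet_Ioi e3,
    lintegral_const_mul' _ _ (ENNReal.mul_ne_top ENNReal.ofReal_ne_top ENNReal.ofReal_ne_top), hs,
    lintegral_const_mul _ (by fun_prop)]
  have hsin := sin_lem lam hlam
  calc _ = ENNReal.ofReal (blam lam / 2) * (∫⁻ x in Ioi (0:ℝ), (g x + g (-x)) * ENNReal.ofReal (x ^ (2 * lam + 1))) *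
      (ENNReal.ofReal (clam lam) * ∫⁻ φ in Ioo (0:ℝ) π, ENNReal.ofReal (sin φ ^ (2 * lam))) := by ring
    _ = _ := by rw [hsin, mul_one]

theorem T_le (lam : ℝ) (hlam : -(1/2 : ℝ) < lam) (t : ℝ) (f : ℝ → ℂ) (hf : Continuous f) (x : ℝ) :
    ‖T lam t f x‖ₑ ≤ ∫⁻ φ, Kv (fun y => ‖f y‖ₑ) t x φ ∂(mw lam) := by
  have g1 : 0 < Gamma (lam + 1) := Gamma_pos_of_pos (by linarith)
  have g2 : 0 < Gamma (lam + 1 / 2) := Gamma_pos_of_pos (by linarith)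
  have hc : 0 ≤ clam lam := by unfold clam; positivity
  have hg : Measurable (fun y => ‖f y‖ₑ) := hf.measurable.enorm
  have hKx : Measurable (Kv (fun y => ‖f y‖ₑ) t x) := Kv_measx _ hg t x
  rw [lint_mw _ _ hKx, T, enorm_mul, show clam lam / 2 = clam lam * (1 / 2) by ring]
  have e1 : ‖((clam lam * (1 / 2) : ℝ) : ℂ)‖ₑ = ENNReal.ofReal (clam lam) * ENNReal.ofReal (1 / 2) := by
    rw [← ENNReal.ofReal_mul hc, ← ofReal_norm_eq_enorm, Complex.norm_real, norm_of_nonneg (by positivity)]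
  rw [e1, mul_assoc]
  gcongr
  refine (mul_le_mul_right (enorm_integral_le_lintegral_enorm _) _).trans ?_
  rw [← lintegral_const_mul' _ _ ENNReal.ofReal_ne_top]
  refine setLIntegral_mono' measurableSet_Ioo fun φ hφ => ?_
  have hs : 0 ≤ sin φ ^ (2 * lam) := rpow_nonneg (sin_pos_of_mem_Ioo hφ).le _
  have hB := abs_le.1 (Bv_abs t x φ)
  rw [enorm_mul, ← mul_assoc]
  have e2 : ‖((sin φ ^ (2 * lam) : ℝ) : ℂ)‖ₑ = ENNReal.ofReal (sin φ ^ (2 * lam)) := by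
    rw [← ofReal_norm_eq_enorm, Complex.norm_real, norm_of_nonneg hs]
  rw [e2]
  gcongr
  change ENNReal.ofReal (1 / 2) * ‖f (Av t x φ) * (1 + ((Bv t x φ : ℝ) : ℂ)) +
    f (-Av t x φ) * (1 - ((Bv t x φ : ℝ) : ℂ))‖ₑ ≤ _
  have e3 : ‖(1 + ((Bv t x φ : ℝ) : ℂ))‖ₑ = ENNReal.ofReal (1 + Bv t x φ) := by
    rw [← ofReal_norm_eq_enorm, ← Complex.ofReal_one, ← Complex.ofReal_add, Complex.norm_real,
      norm_of_nonneg (by linarith)]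
  have e4 : ‖(1 - ((Bv t x φ : ℝ) : ℂ))‖ₑ = ENNReal.ofReal (1 - Bv t x φ) := by
    rw [← ofReal_norm_eq_enorm, ← Complex.ofReal_one, ← Complex.ofReal_sub, Complex.norm_real,
      norm_of_nonneg (by linarith)]
  refine (mul_le_mul_right (enorm_add_le _ _) _).trans ?_
  rw [enorm_mul, enorm_mul, e3, e4, Kv, div_eq_mul_one_div (1 + _), div_eq_mul_one_div (1 - _),
    ENNReal.ofReal_mul (by linarith), ENNReal.ofReal_mul (by linarith)]
  apply le_of_eq
  ring

theorem Tp_le (lam : ℝ) (hlam : -(1/2 : ℝ) < lam) (t : ℝ) (f : ℝ → ℂ) (hf : Continuous f) (x : ℝ)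
    (p : ℝ≥0∞) (hp : 1 ≤ p) (hpt : p ≠ ∞) :
    ‖T lam t f x‖ₑ ^ p.toReal ≤ ∫⁻ φ, Kv (fun y => ‖f y‖ₑ ^ p.toReal) t x φ ∂(mw lam) := by
  have := mw_prob lam hlam
  have hp1 : 1 ≤ p.toReal := by
    rwa [← ENNReal.toReal_one, ENNReal.toReal_le_toReal ENNReal.one_ne_top hpt]
  have hp0 : 0 < p.toReal := by linarith
  have hg : Measurable (fun y => ‖f y‖ₑ) := hf.measurable.enorm
  have hKx : Measurable (Kv (fun y => ‖f y‖ₑ) t x) := Kv_measx _ hg t x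
  have h := eLpNorm_le_eLpNorm_of_exponent_le (μ := mw lam) hp (hKx.aestronglyMeasurable)
  rw [eLpNorm_one_eq_lintegral_enorm, eLpNorm_eq_lintegral_rpow_enorm_toReal (by positivity) hpt] at h
  simp only [enorm_eq_self] at h
  have h2 := ENNReal.rpow_le_rpow ((T_le lam hlam t f hf x).trans h) hp0.le
  rw [← ENNReal.rpow_mul, one_div_mul_cancel hp0.ne', ENNReal.rpow_one] at h2
  refine h2.trans (lintegral_mono fun φ => ?_)
  exact ENNReal.rpow_arith_mean_le_arith_mean2_rpow _ _ _ _ (Bsum t x φ) hp1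

theorem sup_le (lam : ℝ) (hlam : -(1/2 : ℝ) < lam) (f : ℝ → ℂ) (hf : Continuous f) (x : ℝ) :
    ‖f x‖ₑ ≤ eLpNormEssSup f (μw lam) := by
  by_contra hx
  push Not at hx
  have h := enorm_ae_le_eLpNormEssSup f (μw lam)
  have hw : Measurable fun x : ℝ => ENNReal.ofReal (blam lam / 2 * |x| ^ (2 * lam + 1)) := by fun_prop
  have hb := half_pos (blam_pos lam hlam)
  generalize eLpNormEssSup f (μw lam) = C at h hx
  rw [μw, ae_withDensity_iff hw] at h
  have h0 : ∀ᵐ y : ℝ, y ≠ 0 := by simp [ae_iff]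
  have h1 : ∀ᵐ y : ℝ, ‖f y‖ₑ ≤ C := by
    filter_upwards [h, h0] with y hy hy0
    refine hy ?_
    have := abs_pos.2 hy0
    have : 0 < blam lam / 2 * |y| ^ (2 * lam + 1) := by positivity
    simpa using this
  have ho : IsOpen {y | C < ‖f y‖ₑ} := isOpen_lt continuous_const hf.enorm
  have := ho.measure_pos volume ⟨x, hx⟩
  rw [ae_iff] at h1
  simp only [not_le] at h1
  exact this.ne' h1

/-- `L^p`-contractivity of the one-dimensional generalized translation:
for `λ > −1/2`, `1 ≤ p ≤ ∞`, `t ∈ ℝ` and every Schwartz function `f` on `ℝ`,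
`‖T^t f‖_{L^p(ℝ,dμ)} ≤ ‖f‖_{L^p(ℝ,dμ)}`. -/
theorem stmt10 (lam : ℝ) (hlam : -(1/2 : ℝ) < lam) (p : ℝ≥0∞) (hp : 1 ≤ p) (t : ℝ)
    (f : SchwartzMap ℝ ℂ) :
    eLpNorm (T lam t f) p (μw lam) ≤ eLpNorm (⇑f) p (μw lam) := by
  have := mw_prob lam hlam
  have hf : Continuous f := f.continuous
  by_cases hpt : p = ∞
  · subst hpt
    rw [eLpNorm_exponent_top, eLpNorm_exponent_top]
    refine eLpNormEssSup_le_of_ae_enorm_bound (Filter.Eventually.of_forall fun x => ?_)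
    refine (T_le lam hlam t f hf x).trans ?_
    have : ∀ φ, Kv (fun y => ‖f y‖ₑ) t x φ ≤ eLpNormEssSup f (μw lam) := by
      intro φ
      unfold Kv
      refine (add_le_add (mul_le_mul_right (sup_le lam hlam f hf _) _)
        (mul_le_mul_right (sup_le lam hlam f hf _) _)).trans ?_
      rw [← add_mul, Bsum, one_mul]
    refine (lintegral_mono this).trans ?_
    simp
  · have hp0 : p ≠ 0 := (zero_lt_one.trans_le hp).ne'
    rw [eLpNorm_eq_lintegral_rpow_enorm_toReal hp0 hpt, eLpNorm_eq_lintegral_rpow_enorm_toReal hp0 hpt]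
    refine ENNReal.rpow_le_rpow ?_ (by positivity)
    rw [← L1_lem lam hlam t (fun y => ‖f y‖ₑ ^ p.toReal) (hf.measurable.enorm.pow_const _)]
    exact lintegral_mono fun x => Tp_le lam hlam t f hf x p hp hpt

end Dunkl1DStmt10
end
end

section
/- Let λ > −1/2 and 1 ≤ p < ∞. For every Schwartz function f on ℝ and every x ∈ ℝ one has (∫_0^∞ |T^t f(x)|^p dν_λ(t))^{1/p} ≤ ‖f‖_{L^p(ℝ,dμ)}, i.e., ∫_0^∞ |T^t f(x)|^p b_λ t^{2λ+1} dt ≤ ∫_ℝ |f(y)|^p (b_λ/2) |y|^{2λ+1} dy. -/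
open MeasureTheory Real
open scoped NNReal ENNReal

noncomputable section

namespace Dunkl1DStmt11

/-- `b_λ = (2^λ Γ(λ+1))⁻¹`. -/
def blam (lam : ℝ) : ℝ := ((2 : ℝ) ^ lam * Real.Gamma (lam + 1))⁻¹

/-- `c_λ = Γ(λ+1)/(√π Γ(λ+1/2))`. -/
def clam (lam : ℝ) : ℝ := Real.Gamma (lam + 1) / (Real.sqrt Real.pi * Real.Gamma (lam + 1/2))

/-- The measure `dμ(x) = (b_λ/2)|x|^{2λ+1} dx` on `ℝ`. -/
def μw (lam : ℝ) : Measure ℝ :=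
  volume.withDensity fun x => ENNReal.ofReal (blam lam / 2 * |x| ^ (2 * lam + 1))

/-- The measure `dν_λ(t) = b_λ t^{2λ+1} dt` on `(0,∞)`. -/
def νw (lam : ℝ) : Measure ℝ :=
  (volume.restrict (Set.Ioi 0)).withDensity fun t => ENNReal.ofReal (blam lam * t ^ (2 * lam + 1))

/-- The one-dimensional Dunkl-type generalized translation operator
`T^t f(x) = (c_λ/2) ∫_0^π [f(A)(1+B) + f(−A)(1−B)] sin^{2λ}φ dφ`,
`A = √(x² + t² − 2xt cos φ)`, `B = (x − t cos φ)/A` (with `B = 0` when `A = 0`, which is Lean's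
division convention). -/
def T (lam t : ℝ) (f : ℝ → ℂ) (x : ℝ) : ℂ :=
  ((clam lam / 2 : ℝ) : ℂ) *
    ∫ φ in Set.Ioo (0 : ℝ) Real.pi,
      ((f (Real.sqrt (x ^ 2 + t ^ 2 - 2 * x * t * Real.cos φ)) *
          (1 + (((x - t * Real.cos φ) /
            Real.sqrt (x ^ 2 + t ^ 2 - 2 * x * t * Real.cos φ) : ℝ) : ℂ)) +
        f (-Real.sqrt (x ^ 2 + t ^ 2 - 2 * x * t * Real.cos φ)) *
          (1 - (((x - t * Real.cos φ) /
            Real.sqrt (x ^ 2 + t ^ 2 - 2 * x * t * Real.cos φ) : ℝ) : ℂ))) *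
        ((Real.sin φ ^ (2 * lam) : ℝ) : ℂ))


lemma polarUpper (G : ℝ → ℝ → ℝ≥0∞) (hG : Measurable (Function.uncurry G)) :
    ∫⁻ t in Set.Ioi (0:ℝ), ∫⁻ φ in Set.Ioo (0:ℝ) Real.pi,
      ENNReal.ofReal t * G (t * Real.cos φ) (t * Real.sin φ)
    = ∫⁻ v in Set.Ioi (0:ℝ), ∫⁻ u, G u v := by
  have hS : MeasurableSet {q : ℝ × ℝ | 0 < q.2} := measurableSet_lt measurable_const measurable_snd
  have hF : Measurable ({q : ℝ × ℝ | 0 < q.2}.indicator (Function.uncurry G)) := hG.indicator hS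
  have h := lintegral_comp_polarCoord_symm ({q : ℝ × ℝ | 0 < q.2}.indicator (Function.uncurry G))
  rw [Measure.volume_eq_prod, lintegral_prod_symm _ hF.aemeasurable] at h
  have hm : Measurable fun p : ℝ × ℝ => ENNReal.ofReal p.1 •
      ({q : ℝ × ℝ | 0 < q.2}.indicator (Function.uncurry G)) (p.1 * Real.cos p.2, p.1 * Real.sin p.2) := by
    simp only [smul_eq_mul]
    exact Measurable.mul (by fun_prop) (hF.comp (by fun_prop))
  have h1 : polarCoord.target = Set.Ioi (0:ℝ) ×ˢ Set.Ioo (-Real.pi) Real.pi := rfl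
  simp only [polarCoord_symm_apply] at h
  rw [h1, ← Measure.prod_restrict, lintegral_prod _ hm.aemeasurable] at h
  have hR : ∫⁻ y, ∫⁻ x, ({q : ℝ × ℝ | 0 < q.2}.indicator (Function.uncurry G)) (x, y)
      = ∫⁻ v in Set.Ioi (0:ℝ), ∫⁻ u, G u v := by
    rw [← lintegral_indicator measurableSet_Ioi]
    congr 1; ext y
    by_cases hy : 0 < y <;> simp [Set.indicator, hy]
  rw [← hR, ← h]
  apply setLIntegral_congr_fun measurableSet_Ioi
  intro t ht
  have ht' : 0 < t := ht
  simp only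
  rw [← lintegral_indicator measurableSet_Ioo, ← lintegral_indicator measurableSet_Ioo]
  congr 1; ext φ
  by_cases h2 : φ ∈ Set.Ioo (0:ℝ) Real.pi
  · have hs := Real.sin_pos_of_pos_of_lt_pi h2.1 h2.2
    have h3 : φ ∈ Set.Ioo (-Real.pi) Real.pi := ⟨by linarith [h2.1, Real.pi_pos], h2.2⟩
    rw [Set.indicator_of_mem h2, Set.indicator_of_mem h3]
    simp [Set.indicator, mul_pos ht' hs]
  · rw [Set.indicator_of_notMem h2]
    by_cases h3 : φ ∈ Set.Ioo (-Real.pi) Real.pi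
    · have h4 : φ ≤ 0 := by
        by_contra hc; exact h2 ⟨not_le.mp hc, h3.2⟩
      have hs := Real.sin_nonpos_of_nonpos_of_neg_pi_le h4 h3.1.le
      have : ¬ 0 < t * Real.sin φ := not_lt.mpr (mul_nonpos_of_nonneg_of_nonpos ht'.le hs)
      simp [Set.indicator, this]
    · rw [Set.indicator_of_notMem h3]

/-- the sine weight -/
def sw (lam φ : ℝ) : ℝ≥0∞ := ENNReal.ofReal (Real.sin φ ^ (2 * lam))

lemma sw_meas (lam : ℝ) : Measurable (sw lam) := by unfold sw; fun_prop

lemma sw_total (lam : ℝ) (hlam : -(1/2 : ℝ) < lam) :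
    ENNReal.ofReal (clam lam) * ∫⁻ φ in Set.Ioo (0:ℝ) Real.pi, sw lam φ = 1 := by
  have hg1 : 0 < Real.Gamma (lam + 1) := Real.Gamma_pos_of_pos (by linarith)
  have hg2 : 0 < Real.Gamma (lam + 1/2) := Real.Gamma_pos_of_pos (by linarith)
  have hpi : 0 < Real.sqrt Real.pi := Real.sqrt_pos.mpr Real.pi_pos
  have key := polarUpper
    (fun u v => ENNReal.ofReal (v ^ (2 * lam)) * ENNReal.ofReal (Real.exp (-(u^2 + v^2)))) (by
      unfold Function.uncurry; fun_prop)
  have gam : ∀ s : ℝ, -1 < s → ∫⁻ r in Set.Ioi (0:ℝ), ENNReal.ofReal (r ^ s * Real.exp (-r^2))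
      = ENNReal.ofReal (1/2 * Real.Gamma ((s+1)/2)) := by
    intro s hs
    have h1 := integral_rpow_mul_exp_neg_rpow (p := 2) (by norm_num) hs
    have h2 := integrableOn_rpow_mul_exp_neg_rpow (p := 2) hs (by norm_num)
    rw [← h1, ofReal_integral_eq_lintegral_ofReal h2]
    · simp
    · filter_upwards [ae_restrict_mem measurableSet_Ioi] with r hr
      have : (0:ℝ) < r := hr
      positivity
  have gau : ∫⁻ u : ℝ, ENNReal.ofReal (Real.exp (-u^2)) = ENNReal.ofReal (Real.sqrt Real.pi) := by
    have h1 := integral_gaussian 1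
    have h2 := integrable_exp_neg_mul_sq (b := 1) one_pos
    simp only [neg_mul, one_mul, div_one] at h1 h2
    rw [← h1, ofReal_integral_eq_lintegral_ofReal h2]
    filter_upwards with u
    positivity
  have hL : ∫⁻ t in Set.Ioi (0:ℝ), ∫⁻ φ in Set.Ioo (0:ℝ) Real.pi,
      ENNReal.ofReal t * (ENNReal.ofReal ((t * Real.sin φ) ^ (2 * lam)) *
        ENNReal.ofReal (Real.exp (-((t * Real.cos φ)^2 + (t * Real.sin φ)^2))))
      = ENNReal.ofReal (1/2 * Real.Gamma (lam + 1)) *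
        ∫⁻ φ in Set.Ioo (0:ℝ) Real.pi, sw lam φ := by
    have := gam (2 * lam + 1) (by linarith)
    rw [show (2 * lam + 1 + 1)/2 = lam + 1 by ring] at this
    rw [← this, ← lintegral_mul_const _ (by fun_prop)]
    apply setLIntegral_congr_fun measurableSet_Ioi
    intro t ht
    have ht' : 0 < t := ht
    simp only
    rw [← lintegral_const_mul _ (sw_meas lam)]
    apply setLIntegral_congr_fun measurableSet_Ioo
    intro φ hφ
    have hs := Real.sin_pos_of_pos_of_lt_pi hφ.1 hφ.2
    simp only [sw]
    rw [← ENNReal.ofReal_mul (by positivity), ← ENNReal.ofReal_mul (by positivity),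
      ← ENNReal.ofReal_mul (by positivity)]
    congr 1
    rw [show (t * Real.cos φ)^2 + (t * Real.sin φ)^2 = t^2 * (Real.sin φ^2 + Real.cos φ^2) by ring,
      Real.sin_sq_add_cos_sq, mul_one, Real.mul_rpow ht'.le hs.le, Real.rpow_add ht', Real.rpow_one]
    ring
  have hRr : ∫⁻ v in Set.Ioi (0:ℝ), ∫⁻ u : ℝ,
      ENNReal.ofReal (v ^ (2 * lam)) * ENNReal.ofReal (Real.exp (-(u^2 + v^2)))
      = ENNReal.ofReal (1/2 * Real.Gamma (lam + 1/2)) * ENNReal.ofReal (Real.sqrt Real.pi) := by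
    have := gam (2 * lam) (by linarith)
    rw [show (2 * lam + 1)/2 = lam + 1/2 by ring] at this
    rw [← this, ← gau, ← lintegral_mul_const _ (by fun_prop)]
    apply setLIntegral_congr_fun measurableSet_Ioi
    intro v hv
    have hv' : 0 < v := hv
    simp only
    rw [← lintegral_const_mul _ (by fun_prop)]
    congr 1; ext u
    rw [← ENNReal.ofReal_mul (by positivity), ← ENNReal.ofReal_mul (by positivity)]
    congr 1
    rw [neg_add, Real.exp_add]; ring
  rw [hL, hRr, ← ENNReal.ofReal_mul (by positivity)] at key
  have e : clam lam = (Real.sqrt Real.pi * Real.Gamma (lam + 1/2))⁻¹ * 2 *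
    (1/2 * Real.Gamma (lam + 1)) := by
    unfold clam; field_simp
  rw [e, ENNReal.ofReal_mul (by positivity), mul_assoc, key, ← ENNReal.ofReal_mul (by positivity),
    ← ENNReal.ofReal_one]
  congr 1
  generalize Real.Gamma (lam + 1/2) = c at *
  field_simp

lemma sw_half (lam : ℝ) (σ : ℝ) (hσ : σ = 1 ∨ σ = -1) :
    ∫⁻ φ in Set.Ioo (0:ℝ) Real.pi, sw lam φ * ENNReal.ofReal ((1 + σ * Real.cos φ)/2)
     = (∫⁻ φ in Set.Ioo (0:ℝ) Real.pi, sw lam φ) / 2 := by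
  have hsm := sw_meas lam
  have key : ∀ τ : ℝ,
     ∫⁻ φ in Set.Ioo (0:ℝ) Real.pi, sw lam φ * ENNReal.ofReal ((1 + τ * Real.cos φ)/2)
     = ∫⁻ φ in Set.Ioo (0:ℝ) Real.pi, sw lam φ * ENNReal.ofReal ((1 + (-τ) * Real.cos φ)/2) := by
    intro τ
    rw [← lintegral_indicator measurableSet_Ioo, ← lintegral_indicator measurableSet_Ioo,
      ← lintegral_sub_left_eq_self _ Real.pi]
    congr 1; ext φ
    have : Real.pi - φ ∈ Set.Ioo (0:ℝ) Real.pi ↔ φ ∈ Set.Ioo (0:ℝ) Real.pi := by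
      simp only [Set.mem_Ioo]; constructor <;> rintro ⟨a, b⟩ <;> constructor <;> linarith
    by_cases h : φ ∈ Set.Ioo (0:ℝ) Real.pi
    · rw [Set.indicator_of_mem h, Set.indicator_of_mem (this.mpr h)]
      simp [sw, Real.sin_pi_sub, Real.cos_pi_sub]
    · rw [Set.indicator_of_notMem h, Set.indicator_of_notMem (fun h' => h (this.mp h'))]
  have hsum : (∫⁻ φ in Set.Ioo (0:ℝ) Real.pi, sw lam φ * ENNReal.ofReal ((1 + σ * Real.cos φ)/2)) +
      ∫⁻ φ in Set.Ioo (0:ℝ) Real.pi, sw lam φ * ENNReal.ofReal ((1 + (-σ) * Real.cos φ)/2)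
      = ∫⁻ φ in Set.Ioo (0:ℝ) Real.pi, sw lam φ := by
    rw [← lintegral_add_left (by fun_prop)]
    congr 1; ext φ
    have h1 := Real.neg_one_le_cos φ
    have h2 := Real.cos_le_one φ
    rw [← mul_add, ← ENNReal.ofReal_add]
    · rw [show (1 + σ * Real.cos φ)/2 + (1 + -σ * Real.cos φ)/2 = 1 by ring]; simp
    · rcases hσ with rfl | rfl <;> linarith
    · rcases hσ with rfl | rfl <;> linarith
  rw [← key, ← two_mul] at hsum
  rw [← hsum, mul_comm, ENNReal.mul_div_cancel_right] <;> simp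

/-- the averaged kernel -/
def HH (g : ℝ → ℝ≥0∞) (u v : ℝ) : ℝ≥0∞ :=
  ENNReal.ofReal ((1 + u / Real.sqrt (u^2 + v^2)) / 2) * g (Real.sqrt (u^2 + v^2)) +
  ENNReal.ofReal ((1 - u / Real.sqrt (u^2 + v^2)) / 2) * g (-Real.sqrt (u^2 + v^2))

lemma HH_meas (g : ℝ → ℝ≥0∞) (hg : Measurable g) : Measurable (Function.uncurry (HH g)) := by
  unfold HH Function.uncurry; fun_prop

lemma HH_polar (g : ℝ → ℝ≥0∞) (t φ : ℝ) (ht : 0 < t) :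
    HH g (t * Real.cos φ) (t * Real.sin φ) =
      ENNReal.ofReal ((1 + 1 * Real.cos φ) / 2) * g t +
      ENNReal.ofReal ((1 + (-1) * Real.cos φ) / 2) * g (-t) := by
  have h : Real.sqrt ((t * Real.cos φ)^2 + (t * Real.sin φ)^2) = t := by
    rw [show (t * Real.cos φ)^2 + (t * Real.sin φ)^2 = t^2 * (Real.sin φ^2 + Real.cos φ^2) by ring,
      Real.sin_sq_add_cos_sq, mul_one, Real.sqrt_sq ht.le]
  unfold HH
  rw [h, mul_div_cancel_left₀ _ ht.ne']
  ring_nf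

lemma weight_eq (lam t φ : ℝ) (ht : 0 < t) (hφ : φ ∈ Set.Ioo (0:ℝ) Real.pi) :
    ENNReal.ofReal t * ENNReal.ofReal ((t * Real.sin φ) ^ (2 * lam)) =
      ENNReal.ofReal (t ^ (2 * lam + 1)) * sw lam φ := by
  have hs := Real.sin_pos_of_pos_of_lt_pi hφ.1 hφ.2
  unfold sw
  rw [← ENNReal.ofReal_mul (by positivity), ← ENNReal.ofReal_mul (by positivity),
    Real.mul_rpow ht.le hs.le, Real.rpow_add ht, Real.rpow_one]
  congr 1; ring

lemma main_id (lam : ℝ) (hlam : -(1/2 : ℝ) < lam) (g : ℝ → ℝ≥0∞) (hg : Measurable g) (x : ℝ) :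
    ∫⁻ t in Set.Ioi (0:ℝ), ENNReal.ofReal (blam lam * t ^ (2 * lam + 1)) *
      ∫⁻ φ in Set.Ioo (0:ℝ) Real.pi, ENNReal.ofReal (clam lam) * sw lam φ *
        HH g (x - t * Real.cos φ) (t * Real.sin φ)
    = ∫⁻ y, ENNReal.ofReal (blam lam / 2 * |y| ^ (2 * lam + 1)) * g y := by
  have hb : 0 < blam lam := by
    have hg1 : 0 < Real.Gamma (lam + 1) := Real.Gamma_pos_of_pos (by linarith)
    unfold blam; positivity
  have hsm := sw_meas lam
  have hm1 : Measurable (Function.uncurry fun u v => ENNReal.ofReal (v ^ (2 * lam)) * HH g (x - u) v) := by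
    unfold Function.uncurry HH; fun_prop
  have hm2 : Measurable (Function.uncurry fun u v => ENNReal.ofReal (v ^ (2 * lam)) * HH g u v) := by
    unfold Function.uncurry HH; fun_prop
  have k1 := polarUpper _ hm1
  have k2 := polarUpper _ hm2
  have k3 : ∫⁻ v in Set.Ioi (0:ℝ), ∫⁻ u : ℝ, ENNReal.ofReal (v ^ (2 * lam)) * HH g (x - u) v
      = ∫⁻ v in Set.Ioi (0:ℝ), ∫⁻ u : ℝ, ENNReal.ofReal (v ^ (2 * lam)) * HH g u v := by
    congr 1; ext v
    exact lintegral_sub_left_eq_self (fun u => ENNReal.ofReal (v ^ (2 * lam)) * HH g u v) x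
  set S := ∫⁻ φ in Set.Ioo (0:ℝ) Real.pi, sw lam φ with hS
  have hCS : ENNReal.ofReal (clam lam) * S = 1 := sw_total lam hlam
  have hL : ∫⁻ t in Set.Ioi (0:ℝ), ENNReal.ofReal (blam lam * t ^ (2 * lam + 1)) *
      ∫⁻ φ in Set.Ioo (0:ℝ) Real.pi, ENNReal.ofReal (clam lam) * sw lam φ *
        HH g (x - t * Real.cos φ) (t * Real.sin φ)
      = ENNReal.ofReal (blam lam) * ENNReal.ofReal (clam lam) *
        ∫⁻ t in Set.Ioi (0:ℝ), ∫⁻ φ in Set.Ioo (0:ℝ) Real.pi, ENNReal.ofReal t *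
        (ENNReal.ofReal ((t * Real.sin φ) ^ (2 * lam)) * HH g (x - t * Real.cos φ) (t * Real.sin φ)) := by
    rw [← lintegral_const_mul' _ _ (by finiteness)]
    apply setLIntegral_congr_fun measurableSet_Ioi
    intro t ht
    have ht' : 0 < t := ht
    simp only
    rw [← lintegral_const_mul' _ _ (by finiteness), ← lintegral_const_mul' _ _ (by finiteness)]
    apply setLIntegral_congr_fun measurableSet_Ioo
    intro φ hφ
    simp only
    rw [← mul_assoc (ENNReal.ofReal t), weight_eq lam t φ ht' hφ, ENNReal.ofReal_mul hb.le]
    ring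
  have hR : ∫⁻ t in Set.Ioi (0:ℝ), ∫⁻ φ in Set.Ioo (0:ℝ) Real.pi, ENNReal.ofReal t *
        (ENNReal.ofReal ((t * Real.sin φ) ^ (2 * lam)) * HH g (t * Real.cos φ) (t * Real.sin φ))
      = (S / 2) * ∫⁻ t in Set.Ioi (0:ℝ), ENNReal.ofReal (t ^ (2 * lam + 1)) * (g t + g (-t)) := by
    rw [← lintegral_const_mul _ (by fun_prop)]
    apply setLIntegral_congr_fun measurableSet_Ioi
    intro t ht
    have ht' : 0 < t := ht
    simp only
    have : ∀ φ ∈ Set.Ioo (0:ℝ) Real.pi, ENNReal.ofReal t *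
        (ENNReal.ofReal ((t * Real.sin φ) ^ (2 * lam)) * HH g (t * Real.cos φ) (t * Real.sin φ))
      = ENNReal.ofReal (t ^ (2 * lam + 1)) * g t *
          (sw lam φ * ENNReal.ofReal ((1 + 1 * Real.cos φ)/2)) +
        ENNReal.ofReal (t ^ (2 * lam + 1)) * g (-t) *
          (sw lam φ * ENNReal.ofReal ((1 + (-1) * Real.cos φ)/2)) := by
      intro φ hφ
      rw [← mul_assoc (ENNReal.ofReal t), weight_eq lam t φ ht' hφ, HH_polar g t φ ht']
      ring
    rw [setLIntegral_congr_fun measurableSet_Ioo this, lintegral_add_left (by fun_prop),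
      lintegral_const_mul _ (by fun_prop), lintegral_const_mul _ (by fun_prop),
      sw_half lam 1 (Or.inl rfl), sw_half lam (-1) (Or.inr rfl), ← hS]
    ring
  rw [hL, k1, k3, ← k2, hR]
  have hneg : ∫⁻ t in Set.Ioi (0:ℝ), ENNReal.ofReal (t ^ (2 * lam + 1)) * g (-t)
      = ∫⁻ t in Set.Iic (0:ℝ), ENNReal.ofReal (|t| ^ (2 * lam + 1)) * g t := by
    rw [← setLIntegral_congr (Iio_ae_eq_Iic (a := (0:ℝ))), ← lintegral_indicator measurableSet_Ioi,
      ← lintegral_indicator measurableSet_Iio, ← lintegral_neg_eq_self]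
    congr 1; ext t
    by_cases h : t < 0
    · simp [Set.indicator, h, abs_of_neg h]
    · simp [Set.indicator, h]
  have hpos : ∫⁻ t in Set.Ioi (0:ℝ), ENNReal.ofReal (t ^ (2 * lam + 1)) * g t
      = ∫⁻ t in Set.Ioi (0:ℝ), ENNReal.ofReal (|t| ^ (2 * lam + 1)) * g t := by
    apply setLIntegral_congr_fun measurableSet_Ioi
    intro t ht
    have ht' : 0 < t := ht
    simp only [abs_of_pos ht']
  have hall : ∫⁻ t in Set.Ioi (0:ℝ), ENNReal.ofReal (t ^ (2 * lam + 1)) * (g t + g (-t))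
      = ∫⁻ y, ENNReal.ofReal (|y| ^ (2 * lam + 1)) * g y := by
    simp only [mul_add]
    rw [lintegral_add_left (by fun_prop), hneg, hpos, ← Set.compl_Ioi]
    exact lintegral_add_compl _ measurableSet_Ioi
  have hfin : ∫⁻ y, ENNReal.ofReal (blam lam / 2 * |y| ^ (2 * lam + 1)) * g y
      = ENNReal.ofReal (blam lam) / 2 * ∫⁻ y, ENNReal.ofReal (|y| ^ (2 * lam + 1)) * g y := by
    rw [← lintegral_const_mul _ (by fun_prop)]
    congr 1; ext y
    rw [ENNReal.ofReal_mul (by positivity), ENNReal.ofReal_div_of_pos (by norm_num)]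
    simp [mul_assoc]
  rw [hall, hfin]
  calc _ = ENNReal.ofReal (blam lam) * (ENNReal.ofReal (clam lam) * S) / 2 *
        ∫⁻ y, ENNReal.ofReal (|y| ^ (2 * lam + 1)) * g y := by
        simp only [div_eq_mul_inv]; ring
    _ = _ := by rw [hCS, mul_one]

lemma HH_conv (f : ℝ → ℂ) (p : ℝ) (hp : 1 ≤ p) (u v : ℝ) :
    ‖(f (Real.sqrt (u^2 + v^2)) * (1 + ((u / Real.sqrt (u^2 + v^2) : ℝ) : ℂ)) +
      f (-Real.sqrt (u^2 + v^2)) * (1 - ((u / Real.sqrt (u^2 + v^2) : ℝ) : ℂ))) / 2‖ₑ ^ p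
    ≤ HH (fun y => ‖f y‖ₑ ^ p) u v := by
  have hB : |u / Real.sqrt (u^2 + v^2)| ≤ 1 := by
    rw [abs_div, abs_of_nonneg (Real.sqrt_nonneg _)]
    apply div_le_one_of_le₀ _ (Real.sqrt_nonneg _)
    exact Real.abs_le_sqrt (by nlinarith [sq_nonneg v])
  unfold HH
  set r := Real.sqrt (u^2 + v^2)
  set B := u / r
  obtain ⟨hB1, hB2⟩ := abs_le.mp hB
  refine le_trans ?_ (ENNReal.rpow_arith_mean_le_arith_mean2_rpow _ _ _ _ ?_ hp)
  · apply ENNReal.rpow_le_rpow _ (by linarith)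
    have e1 : ∀ s : ℝ, 0 ≤ s → ‖(s : ℂ)‖ₑ = ENNReal.ofReal s := by
      intro s hs
      rw [← ofReal_norm, Complex.norm_real, Real.norm_of_nonneg hs]
    have e2 : (f r * (1 + (B:ℂ)) + f (-r) * (1 - (B:ℂ)))/2
      = (((1 + B)/2 : ℝ) : ℂ) * f r + (((1 - B)/2 : ℝ) : ℂ) * f (-r) := by
      push_cast; ring
    rw [e2]
    refine (enorm_add_le _ _).trans ?_
    rw [enorm_mul, enorm_mul, e1 _ (by linarith), e1 _ (by linarith)]
  · rw [← ENNReal.ofReal_add (by linarith) (by linarith), ← ENNReal.ofReal_one]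
    congr 1; ring

lemma T_jensen (lam : ℝ) (hlam : -(1/2 : ℝ) < lam) (p : ℝ) (hp : 1 ≤ p)
    (f : ℝ → ℂ) (hf : Measurable f) (x t : ℝ) :
    ‖T lam t f x‖ₑ ^ p ≤ ∫⁻ φ in Set.Ioo (0:ℝ) Real.pi, ENNReal.ofReal (clam lam) * sw lam φ *
        HH (fun y => ‖f y‖ₑ ^ p) (x - t * Real.cos φ) (t * Real.sin φ) := by
  have hc : 0 < clam lam := by
    have hg1 : 0 < Real.Gamma (lam + 1) := Real.Gamma_pos_of_pos (by linarith)
    have hg2 : 0 < Real.Gamma (lam + 1/2) := Real.Gamma_pos_of_pos (by linarith)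
    have hpi : 0 < Real.sqrt Real.pi := Real.sqrt_pos.mpr Real.pi_pos
    unfold clam; positivity
  have hsm := sw_meas lam
  set σ : Measure ℝ := (volume.restrict (Set.Ioo (0:ℝ) Real.pi)).withDensity
    (fun φ => ENNReal.ofReal (clam lam) * sw lam φ) with hσ
  have hdm : Measurable (fun φ => ENNReal.ofReal (clam lam) * sw lam φ) := by fun_prop
  have : IsProbabilityMeasure σ := ⟨by
    rw [hσ, withDensity_apply _ MeasurableSet.univ, Measure.restrict_univ,
      lintegral_const_mul _ hsm, sw_total lam hlam]⟩
  let F : ℝ → ℂ := fun φ =>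
    let u := x - t * Real.cos φ
    let v := t * Real.sin φ
    (f (Real.sqrt (u^2 + v^2)) * (1 + ((u / Real.sqrt (u^2 + v^2) : ℝ) : ℂ)) +
      f (-Real.sqrt (u^2 + v^2)) * (1 - ((u / Real.sqrt (u^2 + v^2) : ℝ) : ℂ))) / 2
  have hF : Measurable F := by
    simp only [F]; fun_prop
  have hT : T lam t f x = ∫ φ, F φ ∂σ := by
    rw [hσ, integral_withDensity_eq_integral_toReal_smul hdm (by
      filter_upwards with φ; unfold sw; finiteness)]
    unfold T
    rw [← integral_const_mul]
    apply setIntegral_congr_fun measurableSet_Ioo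
    intro φ hφ
    have hs := Real.sin_pos_of_pos_of_lt_pi hφ.1 hφ.2
    have hq : x ^ 2 + t ^ 2 - 2 * x * t * Real.cos φ = (x - t * Real.cos φ)^2 + (t * Real.sin φ)^2 := by
      have := Real.sin_sq_add_cos_sq φ
      linear_combination (-t^2) * this
    simp only [F, hq, sw]
    rw [ENNReal.toReal_mul, ENNReal.toReal_ofReal hc.le, ENNReal.toReal_ofReal (by positivity),
      Complex.real_smul]
    push_cast
    ring
  have h1 : ‖T lam t f x‖ₑ ≤ eLpNorm' F p σ := by
    rw [hT]
    refine (enorm_integral_le_lintegral_enorm _).trans ?_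
    refine le_trans (le_of_eq ?_)
      (eLpNorm'_le_eLpNorm'_of_exponent_le one_pos hp σ hF.aestronglyMeasurable)
    simp [eLpNorm']
  calc ‖T lam t f x‖ₑ ^ p ≤ (eLpNorm' F p σ) ^ p := ENNReal.rpow_le_rpow h1 (by linarith)
    _ = ∫⁻ φ, ‖F φ‖ₑ ^ p ∂σ := by
      rw [eLpNorm', ← ENNReal.rpow_mul, one_div, inv_mul_cancel₀ (by linarith), ENNReal.rpow_one]
    _ = ∫⁻ φ in Set.Ioo (0:ℝ) Real.pi, ENNReal.ofReal (clam lam) * sw lam φ * ‖F φ‖ₑ ^ p := by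
      rw [hσ, lintegral_withDensity_eq_lintegral_mul _ hdm (by fun_prop)]
      rfl
    _ ≤ _ := by
      apply lintegral_mono
      intro φ
      simp only
      gcongr
      exact HH_conv f p hp _ _

/-- for `λ > −1/2`, `1 ≤ p < ∞`, every Schwartz function `f` on `ℝ` and every
`x ∈ ℝ`, `(∫_0^∞ |T^t f(x)|^p dν_λ(t))^{1/p} ≤ ‖f‖_{L^p(ℝ,dμ)}`. -/
theorem stmt11 (lam : ℝ) (hlam : -(1/2 : ℝ) < lam) (p : ℝ) (hp : 1 ≤ p)
    (f : SchwartzMap ℝ ℂ) (x : ℝ) :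
    eLpNorm (fun t => T lam t f x) (ENNReal.ofReal p) (νw lam) ≤
      eLpNorm (⇑f) (ENNReal.ofReal p) (μw lam) := by
  have hp0 : 0 < p := by linarith
  have hb : 0 < blam lam := by
    have hg1 : 0 < Real.Gamma (lam + 1) := Real.Gamma_pos_of_pos (by linarith)
    unfold blam; positivity
  have hf : Measurable (f : ℝ → ℂ) := f.continuous.measurable
  have hne : ENNReal.ofReal p ≠ 0 := by simpa using hp0
  rw [eLpNorm_eq_lintegral_rpow_enorm_toReal hne ENNReal.ofReal_ne_top,
    eLpNorm_eq_lintegral_rpow_enorm_toReal hne ENNReal.ofReal_ne_top, ENNReal.toReal_ofReal hp0.le]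
  apply ENNReal.rpow_le_rpow _ (by positivity)
  unfold νw μw
  have hd1 : Measurable fun t : ℝ => ENNReal.ofReal (blam lam * t ^ (2 * lam + 1)) := by fun_prop
  have hd2 : Measurable fun t : ℝ => ENNReal.ofReal (blam lam / 2 * |t| ^ (2 * lam + 1)) := by
    fun_prop
  rw [lintegral_withDensity_eq_lintegral_mul_non_measurable _ hd1
      (by filter_upwards with t; finiteness),
    lintegral_withDensity_eq_lintegral_mul _ hd2 (by fun_prop)]
  simp only [Pi.mul_apply]
  rw [← main_id lam hlam (fun y => ‖f y‖ₑ ^ p) (by fun_prop) x]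
  apply lintegral_mono
  intro t
  simp only
  gcongr
  exact T_jensen lam hlam p hp f hf x t

end Dunkl1DStmt11
end
end

section
/- (Young's inequality for the one-dimensional generalized convolution.) Let λ > −1/2, let 1 ≤ p, q ≤ ∞ with 1/p + 1/q ≥ 1, and define r by 1/r = 1/p + 1/q − 1. Let f be a Schwartz function on ℝ and let g : (0,∞) → ℂ be the restriction to (0,∞) of an even Schwartz function on ℝ. Define the convolution (f ∗_λ g)(x) = ∫_0^∞ T^t f(x) g(t) dν_λ(t). Then ‖f ∗_λ g‖_{L^r(ℝ,dμ)} ≤ ‖f‖_{L^p(ℝ,dμ)} · ‖g‖_{L^q((0,∞),dν_λ)}. -/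
open MeasureTheory Real
open scoped NNReal ENNReal

noncomputable section

namespace Dunkl1DStmt12

/-- `b_λ = (2^λ Γ(λ+1))⁻¹`. -/
def blam (lam : ℝ) : ℝ := ((2 : ℝ) ^ lam * Real.Gamma (lam + 1))⁻¹

/-- `c_λ = Γ(λ+1)/(√π Γ(λ+1/2))`. -/
def clam (lam : ℝ) : ℝ := Real.Gamma (lam + 1) / (Real.sqrt Real.pi * Real.Gamma (lam + 1/2))

/-- The measure `dμ(x) = (b_λ/2)|x|^{2λ+1} dx` on `ℝ`. -/
def μw (lam : ℝ) : Measure ℝ :=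
  volume.withDensity fun x => ENNReal.ofReal (blam lam / 2 * |x| ^ (2 * lam + 1))

/-- The measure `dν_λ(t) = b_λ t^{2λ+1} dt` on `(0,∞)`. -/
def νw (lam : ℝ) : Measure ℝ :=
  (volume.restrict (Set.Ioi 0)).withDensity fun t => ENNReal.ofReal (blam lam * t ^ (2 * lam + 1))

/-- The one-dimensional Dunkl-type generalized translation operator
`T^t f(x) = (c_λ/2) ∫_0^π [f(A)(1+B) + f(−A)(1−B)] sin^{2λ}φ dφ`,
`A = √(x² + t² − 2xt cos φ)`, `B = (x − t cos φ)/A` (with `B = 0` when `A = 0`, which is Lean's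
division convention). -/
def T (lam t : ℝ) (f : ℝ → ℂ) (x : ℝ) : ℂ :=
  ((clam lam / 2 : ℝ) : ℂ) *
    ∫ φ in Set.Ioo (0 : ℝ) Real.pi,
      ((f (Real.sqrt (x ^ 2 + t ^ 2 - 2 * x * t * Real.cos φ)) *
          (1 + (((x - t * Real.cos φ) /
            Real.sqrt (x ^ 2 + t ^ 2 - 2 * x * t * Real.cos φ) : ℝ) : ℂ)) +
        f (-Real.sqrt (x ^ 2 + t ^ 2 - 2 * x * t * Real.cos φ)) *
          (1 - (((x - t * Real.cos φ) /
            Real.sqrt (x ^ 2 + t ^ 2 - 2 * x * t * Real.cos φ) : ℝ) : ℂ))) *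
        ((Real.sin φ ^ (2 * lam) : ℝ) : ℂ))



/-- The angular measure. -/
def rho (lam : ℝ) : Measure ℝ :=
  (volume.restrict (Set.Ioo 0 Real.pi)).withDensity
    fun φ => ENNReal.ofReal (clam lam * Real.sin φ ^ (2 * lam))

lemma blam_pos {lam : ℝ} (hlam : -(1/2 : ℝ) < lam) : 0 < blam lam := by
  unfold blam
  have := Real.Gamma_pos_of_pos (show 0 < lam + 1 by linarith)
  positivity

lemma clam_pos {lam : ℝ} (hlam : -(1/2 : ℝ) < lam) : 0 < clam lam := by
  unfold clam
  have := Real.Gamma_pos_of_pos (show 0 < lam + 1 by linarith)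
  have := Real.Gamma_pos_of_pos (show 0 < lam + 1/2 by linarith)
  positivity

lemma half_image : (fun φ : ℝ => (1 - Real.cos φ) / 2) '' Set.Ioo 0 Real.pi = Set.Ioo 0 1 := by
  ext y
  constructor
  · rintro ⟨φ, hφ, rfl⟩
    have h1 : Real.cos φ < Real.cos 0 :=
      Real.strictAntiOn_cos ⟨le_rfl, pi_pos.le⟩ ⟨hφ.1.le, hφ.2.le⟩ hφ.1
    have h2 : Real.cos Real.pi < Real.cos φ :=
      Real.strictAntiOn_cos ⟨hφ.1.le, hφ.2.le⟩ ⟨pi_pos.le, le_rfl⟩ hφ.2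
    rw [Real.cos_zero] at h1
    rw [Real.cos_pi] at h2
    constructor <;> dsimp only <;> linarith
  · rintro ⟨h0, h1⟩
    refine ⟨Real.arccos (1 - 2 * y), ⟨Real.arccos_pos.2 (by linarith), ?_⟩, ?_⟩
    · refine lt_of_le_of_ne (Real.arccos_le_pi _) fun h => ?_
      rw [Real.arccos_eq_pi] at h
      linarith
    · dsimp only
      rw [Real.cos_arccos (by linarith) (by linarith)]
      ring

lemma rho_univ {lam : ℝ} (hlam : -(1/2 : ℝ) < lam) : rho lam Set.univ = 1 := by
  have ha : 0 < lam + 1/2 := by linarith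
  rw [rho, withDensity_apply _ MeasurableSet.univ, Measure.restrict_univ,
    ← ProbabilityTheory.lintegral_betaPDF_eq_one ha ha, ProbabilityTheory.lintegral_betaPDF,
    ← half_image, lintegral_image_eq_lintegral_abs_deriv_mul (f' := fun φ => Real.sin φ / 2)
      measurableSet_Ioo]
  · refine setLIntegral_congr_fun measurableSet_Ioo fun φ hφ => ?_
    have hs : 0 < Real.sin φ := Real.sin_pos_of_mem_Ioo hφ
    have hi : (1 - Real.cos φ) / 2 ∈ Set.Ioo (0:ℝ) 1 := half_image ▸ ⟨φ, hφ, rfl⟩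
    rw [← ENNReal.ofReal_mul (abs_nonneg _)]
    congr 1
    rw [abs_of_pos (by positivity), mul_assoc (1 / _),
      ← Real.mul_rpow hi.1.le (by linarith [hi.2])]
    have e : (1 - Real.cos φ) / 2 * (1 - (1 - Real.cos φ) / 2) = (Real.sin φ / 2) ^ (2:ℝ) := by
      rw [Real.rpow_two, div_pow, Real.sin_sq]; ring
    rw [e, ← Real.rpow_mul (by positivity)]
    have e2 : Real.sin φ / 2 * (1 / ProbabilityTheory.beta (lam + 1/2) (lam + 1/2) *
        (Real.sin φ / 2) ^ (2 * (lam + 1/2 - 1))) =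
        (1 / ProbabilityTheory.beta (lam + 1/2) (lam + 1/2)) * (Real.sin φ / 2) ^ (2 * lam) := by
      have : 2 * lam = 2 * (lam + 1/2 - 1) + 1 := by ring
      rw [this, Real.rpow_add_one (by positivity)]
      ring
    rw [e2, Real.div_rpow hs.le (by norm_num)]
    have e3 : clam lam = 1 / ProbabilityTheory.beta (lam + 1/2) (lam + 1/2) / 2 ^ (2 * lam) := by
      have d := Real.Gamma_mul_Gamma_add_half (lam + 1/2)
      have g1 := Real.Gamma_pos_of_pos ha
      have g2 := Real.Gamma_pos_of_pos (show 0 < lam + 1 by linarith)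
      have g3 := Real.Gamma_pos_of_pos (show 0 < 2 * (lam + 1/2) by linarith)
      have e4 : lam + 1/2 + 1/2 = lam + 1 := by ring
      have e5 : lam + 1/2 + (lam + 1/2) = 2 * (lam + 1/2) := by ring
      have e6 : (1:ℝ) - 2 * (lam + 1/2) = - (2 * lam) := by ring
      rw [e4, e6, Real.rpow_neg (by norm_num)] at d
      unfold clam ProbabilityTheory.beta
      rw [e5]
      have h2 : (0:ℝ) < 2 ^ (2 * lam) := by positivity
      have hpi : 0 < √π := by positivity
      generalize Real.Gamma (lam + 1/2) = X at *
      generalize Real.Gamma (lam + 1) = Y at *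
      generalize Real.Gamma (2 * (lam + 1/2)) = Z at *
      generalize (2:ℝ) ^ (2 * lam) = W at *
      field_simp at d ⊢
      linarith
    rw [e3]
    ring
  · intro φ _
    have := (((Real.hasDerivAt_cos φ).const_sub 1).div_const 2).hasDerivWithinAt
      (s := Set.Ioo 0 Real.pi)
    simpa using this
  · intro a ha b hb h
    dsimp only at h
    exact Real.injOn_cos ⟨ha.1.le, ha.2.le⟩ ⟨hb.1.le, hb.2.le⟩ (by linarith)

/-- The reflection symmetry of the angular measure. -/
lemma rho_reflect (lam : ℝ) (H : ℝ → ℝ≥0∞) (hH : Measurable H) :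
    ∫⁻ φ, H (Real.pi - φ) ∂(rho lam) = ∫⁻ φ, H φ ∂(rho lam) := by
  have hw : Measurable fun φ : ℝ => ENNReal.ofReal (clam lam * Real.sin φ ^ (2 * lam)) := by
    fun_prop
  rw [rho, lintegral_withDensity_eq_lintegral_mul _ hw hH,
    lintegral_withDensity_eq_lintegral_mul _ hw (by fun_prop), ← lintegral_indicator measurableSet_Ioo,
    ← lintegral_indicator measurableSet_Ioo,
    ← lintegral_sub_left_eq_self (Set.indicator (Set.Ioo 0 Real.pi) _) Real.pi]
  refine lintegral_congr fun φ => ?_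
  simp only [Set.indicator, Pi.mul_apply, Set.mem_Ioo, Real.sin_pi_sub, sub_sub_cancel]
  have : (0 < π - φ ∧ π - φ < π) ↔ (0 < φ ∧ φ < π) := by
    constructor <;> rintro ⟨h1, h2⟩ <;> constructor <;> linarith
  simp only [this]


/-- Abstract Young inequality. -/
lemma young_abstract (mu nu : Measure ℝ) (m : ℝ → Measure (ℝ × ℝ))
    (hsnd : ∀ x, (m x).map Prod.snd = mu) (hfst : ∀ x, (m x).map Prod.fst = nu)
    (hmeas : ∀ H : ℝ × ℝ → ℝ≥0∞, Measurable H → Measurable fun x => ∫⁻ z, H z ∂(m x))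
    (htot : ∀ u v : ℝ → ℝ≥0∞, Measurable u → Measurable v →
      ∫⁻ x, ∫⁻ z, u z.2 * v z.1 ∂(m x) ∂mu = (∫⁻ y, u y ∂mu) * ∫⁻ t, v t ∂nu)
    (p q r : ℝ≥0∞) (hp : 1 ≤ p) (hq : 1 ≤ q)
    (hpq : 1 ≤ p⁻¹ + q⁻¹) (hr : r⁻¹ = p⁻¹ + q⁻¹ - 1)
    (f g h : ℝ → ℂ) (hf : Measurable f) (hg : Measurable g)
    (hh : ∀ x, ‖h x‖ₑ ≤ ∫⁻ z, ‖f z.2‖ₑ * ‖g z.1‖ₑ ∂(m x)) :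
    eLpNorm h r mu ≤ eLpNorm f p mu * eLpNorm g q nu := by
  have hsum : p⁻¹ + q⁻¹ = r⁻¹ + 1 := by rw [hr, tsub_add_cancel_of_le hpq]
  have hp1 : p⁻¹ ≤ 1 := ENNReal.inv_le_one.2 hp
  have hq1 : q⁻¹ ≤ 1 := ENNReal.inv_le_one.2 hq
  by_cases hrt : r = ∞
  · subst hrt
    have hc : p⁻¹ + q⁻¹ = 1⁻¹ := by simpa using hsum
    have : ENNReal.HolderTriple p q 1 := ⟨hc⟩
    rw [eLpNorm_exponent_top]
    refine eLpNormEssSup_le_of_ae_enorm_bound (Filter.Eventually.of_forall fun x => ?_)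
    refine (hh x).trans ?_
    have h1 := eLpNorm_smul_le_mul_eLpNorm (p := p) (q := q) (r := 1) (μ := m x)
      (f := g ∘ Prod.fst) (φ := f ∘ Prod.snd)
      (hg.comp measurable_fst).aestronglyMeasurable (hf.comp measurable_snd).aestronglyMeasurable
    rw [eLpNorm_one_eq_lintegral_enorm] at h1
    rw [← eLpNorm_map_measure hf.aestronglyMeasurable measurable_snd.aemeasurable,
      ← eLpNorm_map_measure hg.aestronglyMeasurable measurable_fst.aemeasurable, hsnd, hfst] at h1
    simpa [enorm_mul] using h1
  · have hr0' : r⁻¹ ≠ 0 := by simpa using hrt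
    have hpt : p ≠ ∞ := by
      rintro rfl
      have h2 : r⁻¹ + 1 ≤ 0 + 1 := by rw [← hsum]; simpa using hq1
      have := (ENNReal.add_le_add_iff_right ENNReal.one_ne_top).1 h2
      exact hr0' (le_antisymm this bot_le)
    have hqt : q ≠ ∞ := by
      rintro rfl
      have h2 : r⁻¹ + 1 ≤ 0 + 1 := by rw [← hsum]; simpa using hp1
      have := (ENNReal.add_le_add_iff_right ENNReal.one_ne_top).1 h2
      exact hr0' (le_antisymm this bot_le)
    have hr0 : r ≠ 0 := by
      rintro rfl
      have : p⁻¹ + q⁻¹ ≠ ∞ := ENNReal.add_ne_top.2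
        ⟨(hp1.trans_lt ENNReal.one_lt_top).ne, (hq1.trans_lt ENNReal.one_lt_top).ne⟩
      rw [hsum] at this
      simp at this
    have hp0 : p ≠ 0 := (zero_lt_one.trans_le hp).ne'
    have hq0 : q ≠ 0 := (zero_lt_one.trans_le hq).ne'
    rw [eLpNorm_eq_lintegral_rpow_enorm_toReal hr0 hrt, eLpNorm_eq_lintegral_rpow_enorm_toReal hp0 hpt,
      eLpNorm_eq_lintegral_rpow_enorm_toReal hq0 hqt]
    have hs : p.toReal⁻¹ + q.toReal⁻¹ = r.toReal⁻¹ + 1 := by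
      have := congrArg ENNReal.toReal hsum
      rwa [ENNReal.toReal_add (by simpa) (by simpa), ENNReal.toReal_add (by simpa) (by simp),
        ENNReal.toReal_inv, ENNReal.toReal_inv, ENNReal.toReal_inv, ENNReal.toReal_one] at this
    have hP1 : p.toReal⁻¹ ≤ 1 := by
      rw [← ENNReal.toReal_inv]; exact ENNReal.toReal_le_of_le_ofReal (by simp) (by simpa)
    have hQ1 : q.toReal⁻¹ ≤ 1 := by
      rw [← ENNReal.toReal_inv]; exact ENNReal.toReal_le_of_le_ofReal (by simp) (by simpa)
    have hP : 0 < p.toReal := ENNReal.toReal_pos hp0 hpt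
    have hQ : 0 < q.toReal := ENNReal.toReal_pos hq0 hqt
    have hR : 0 < r.toReal := ENNReal.toReal_pos hr0 hrt
    generalize p.toReal = P at *
    generalize q.toReal = Q at *
    generalize r.toReal = R at *
    simp only [one_div]
    set a := ∫⁻ y, ‖f y‖ₑ ^ P ∂mu with ha
    set b := ∫⁻ t, ‖g t‖ₑ ^ Q ∂nu with hb
    have hmf : Measurable fun y => ‖f y‖ₑ ^ P := by fun_prop
    have hmg : Measurable fun y => ‖g y‖ₑ ^ Q := by fun_prop
    set I : ℝ → ℝ≥0∞ := fun x => ∫⁻ z, ‖f z.2‖ₑ ^ P * ‖g z.1‖ₑ ^ Q ∂(m x) with hI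
    have hRi : 0 < R⁻¹ := inv_pos.2 hR
    have ha' : ∀ x, ∫⁻ z, ‖f z.2‖ₑ ^ P ∂(m x) = a := fun x => by
      rw [ha, ← hsnd x, lintegral_map hmf measurable_snd]
    have hb' : ∀ x, ∫⁻ z, ‖g z.1‖ₑ ^ Q ∂(m x) = b := fun x => by
      rw [hb, ← hfst x, lintegral_map hmg measurable_fst]
    have e1 : 0 ≤ P⁻¹ - R⁻¹ := by linarith
    have e2 : 0 ≤ Q⁻¹ - R⁻¹ := by linarith
    have key : ∀ x, ‖h x‖ₑ ≤ I x ^ R⁻¹ * a ^ (P⁻¹ - R⁻¹) * b ^ (Q⁻¹ - R⁻¹) := by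
      intro x
      refine (hh x).trans ?_
      have := ENNReal.lintegral_prod_norm_pow_le (μ := m x) (Finset.univ : Finset (Fin 3))
        (f := ![fun z => ‖f z.2‖ₑ ^ P * ‖g z.1‖ₑ ^ Q, fun z => ‖f z.2‖ₑ ^ P, fun z => ‖g z.1‖ₑ ^ Q])
        (p := ![R⁻¹, P⁻¹ - R⁻¹, Q⁻¹ - R⁻¹])
        (by
          intro i _
          fin_cases i
          · exact ((hmf.comp measurable_snd).mul (hmg.comp measurable_fst)).aemeasurable
          · exact (hmf.comp measurable_snd).aemeasurable
          · exact (hmg.comp measurable_fst).aemeasurable)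
        (by simp [Fin.sum_univ_three]; linarith)
        (by intro i _; fin_cases i; exacts [hRi.le, e1, e2])
      simp only [Fin.prod_univ_three, Matrix.cons_val] at this
      rw [ha', hb'] at this
      refine le_trans (le_of_eq (lintegral_congr fun z => ?_)) this
      rw [ENNReal.mul_rpow_of_nonneg _ _ hRi.le]
      have t1 : ∀ (w : ℝ≥0∞) (S : ℝ), 0 < S → 0 ≤ S⁻¹ - R⁻¹ →
          (w ^ S) ^ R⁻¹ * (w ^ S) ^ (S⁻¹ - R⁻¹) = w := by
        intro w S hS h0
        rw [← ENNReal.rpow_add_of_nonneg _ _ hRi.le h0, ← ENNReal.rpow_mul]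
        have : S * (R⁻¹ + (S⁻¹ - R⁻¹)) = 1 := by field_simp; ring
        rw [this, ENNReal.rpow_one]
      conv_lhs => rw [← t1 ‖f z.2‖ₑ P hP e1, ← t1 ‖g z.1‖ₑ Q hQ e2]
      ring
    have htot' : ∫⁻ x, I x ∂mu = a * b := htot _ _ hmf hmg
    have hImeas : Measurable I := hmeas _
      ((hmf.comp measurable_snd).mul (hmg.comp measurable_fst))
    calc (∫⁻ x, ‖h x‖ₑ ^ R ∂mu) ^ R⁻¹
        ≤ (∫⁻ x, I x * (a ^ (P⁻¹ - R⁻¹) * b ^ (Q⁻¹ - R⁻¹)) ^ R ∂mu) ^ R⁻¹ := by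
          gcongr with x
          refine (ENNReal.rpow_le_rpow (key x) hR.le).trans (le_of_eq ?_)
          rw [mul_assoc, ENNReal.mul_rpow_of_nonneg _ _ hR.le, ENNReal.rpow_inv_rpow hR.ne']
      _ = (a * b) ^ R⁻¹ * (a ^ (P⁻¹ - R⁻¹) * b ^ (Q⁻¹ - R⁻¹)) := by
          rw [lintegral_mul_const _ hImeas, htot', ENNReal.mul_rpow_of_nonneg _ _ hRi.le,
            ENNReal.rpow_rpow_inv hR.ne']
      _ = (a ^ R⁻¹ * a ^ (P⁻¹ - R⁻¹)) * (b ^ R⁻¹ * b ^ (Q⁻¹ - R⁻¹)) := by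
          rw [ENNReal.mul_rpow_of_nonneg _ _ hRi.le]; ring
      _ = a ^ P⁻¹ * b ^ Q⁻¹ := by
          rw [← ENNReal.rpow_add_of_nonneg _ _ hRi.le e1, ← ENNReal.rpow_add_of_nonneg _ _ hRi.le e2]
          simp
      _ ≤ _ := le_rfl


instance (lam : ℝ) : SFinite (νw lam) := by unfold νw; infer_instance
instance (lam : ℝ) : SFinite (μw lam) := by unfold μw; infer_instance
instance (lam : ℝ) : SFinite (rho lam) := by unfold rho; infer_instance

/-- `A`. -/
def Af (x t φ : ℝ) : ℝ := Real.sqrt (x ^ 2 + t ^ 2 - 2 * x * t * Real.cos φ)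

/-- `B`. -/
def Bf (x t φ : ℝ) : ℝ := (x - t * Real.cos φ) / Af x t φ

lemma measurable_Af : Measurable fun z : ℝ × ℝ × ℝ => Af z.1 z.2.1 z.2.2 := by
  unfold Af; fun_prop

lemma measurable_Bf : Measurable fun z : ℝ × ℝ × ℝ => Bf z.1 z.2.1 z.2.2 := by
  unfold Bf Af; fun_prop

@[fun_prop]
lemma Measurable.Af' {α : Type*} [MeasurableSpace α] {a b c : α → ℝ} (ha : Measurable a)
    (hb : Measurable b) (hc : Measurable c) : Measurable fun z => Af (a z) (b z) (c z) :=
  measurable_Af.comp (ha.prodMk (hb.prodMk hc))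

@[fun_prop]
lemma Measurable.Bf' {α : Type*} [MeasurableSpace α] {a b c : α → ℝ} (ha : Measurable a)
    (hb : Measurable b) (hc : Measurable c) : Measurable fun z => Bf (a z) (b z) (c z) :=
  measurable_Bf.comp (ha.prodMk (hb.prodMk hc))

lemma Bf_abs_le (x t φ : ℝ) : |Bf x t φ| ≤ 1 := by
  unfold Bf
  rw [abs_div, abs_of_nonneg (show 0 ≤ Af x t φ from Real.sqrt_nonneg _)]
  refine div_le_one_of_le₀ ?_ (Real.sqrt_nonneg _)
  refine Real.abs_le_sqrt ?_
  have := Real.sin_sq_add_cos_sq φ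
  nlinarith [sq_nonneg (t * Real.sin φ)]

lemma polar_lemma {lam : ℝ} (hlam : -(1/2 : ℝ) < lam) (H : ℝ × ℝ → ℝ≥0∞) (hH : Measurable H) :
    ∫⁻ z, H (z.1 * Real.cos z.2, z.1 * Real.sin z.2) ∂((νw lam).prod (rho lam)) =
      ∫⁻ z : ℝ × ℝ, (Set.Ioi (0:ℝ)).indicator
        (fun v => ENNReal.ofReal (blam lam * clam lam * v ^ (2 * lam))) z.2 * H z := by
  have hb := blam_pos hlam
  have hc := clam_pos hlam
  rw [νw, rho, prod_withDensity (by fun_prop) (by fun_prop), Measure.prod_restrict,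
    lintegral_withDensity_eq_lintegral_mul _ (by fun_prop) (by fun_prop),
    ← lintegral_comp_polarCoord_symm, ← lintegral_indicator (measurableSet_Ioi.prod measurableSet_Ioo),
    ← lintegral_indicator polarCoord.open_target.measurableSet]
  refine lintegral_congr fun z => ?_
  obtain ⟨t, φ⟩ := z
  simp only [Set.indicator, polarCoord_target, polarCoord_symm_apply, Set.mem_prod, Set.mem_Ioi,
    Set.mem_Ioo, Pi.mul_apply, smul_eq_mul]
  by_cases ht : 0 < t
  swap
  · simp [ht]
  by_cases hφ : -π < φ ∧ φ < π
  swap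
  · have : ¬ (0 < φ ∧ φ < π) := fun h => hφ ⟨by linarith [pi_pos], h.2⟩
    simp [hφ, this]
  by_cases h0 : 0 < φ
  · have hs : 0 < Real.sin φ := Real.sin_pos_of_mem_Ioo ⟨h0, hφ.2⟩
    have hts : 0 < t * Real.sin φ := mul_pos ht hs
    rw [if_pos ⟨ht, h0, hφ.2⟩, if_pos ⟨ht, hφ⟩, if_pos hts, ← mul_assoc]
    congr 1
    rw [← ENNReal.ofReal_mul (by positivity), ← ENNReal.ofReal_mul ht.le]
    congr 1
    rw [Real.mul_rpow ht.le hs.le, Real.rpow_add_one ht.ne']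
    ring
  · have hs : ¬ 0 < t * Real.sin φ := by
      have : Real.sin φ ≤ 0 := Real.sin_nonpos_of_nonpos_of_neg_pi_le (not_lt.1 h0) hφ.1.le
      nlinarith
    simp [h0, hs]

lemma polar_key {lam : ℝ} (hlam : -(1/2 : ℝ) < lam) (Φ : ℝ × ℝ → ℝ≥0∞) (hΦ : Measurable Φ) (x : ℝ) :
    ∫⁻ z, Φ (Af x z.1 z.2, Bf x z.1 z.2) ∂((νw lam).prod (rho lam)) =
      ∫⁻ z, Φ (z.1, Real.cos z.2) ∂((νw lam).prod (rho lam)) := by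
  set K : ℝ × ℝ → ℝ≥0∞ := fun w => Φ (Real.sqrt (w.1 ^ 2 + w.2 ^ 2), w.1 / Real.sqrt (w.1 ^ 2 + w.2 ^ 2))
    with hK
  have hKm : Measurable K := by fun_prop
  have h1 := polar_lemma hlam (fun w => K (x - w.1, w.2)) (by fun_prop)
  have h2 := polar_lemma hlam K hKm
  have e1 : ∀ z : ℝ × ℝ, K (x - z.1 * Real.cos z.2, z.1 * Real.sin z.2) =
      Φ (Af x z.1 z.2, Bf x z.1 z.2) := by
    intro z
    have : (x - z.1 * Real.cos z.2) ^ 2 + (z.1 * Real.sin z.2) ^ 2 =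
        x ^ 2 + z.1 ^ 2 - 2 * x * z.1 * Real.cos z.2 := by
      rw [mul_pow z.1 (Real.sin _), Real.sin_sq]; ring
    simp only [hK, Bf, Af, this]
  simp only [e1] at h1
  rw [h1]
  have e2 : ∫⁻ z, Φ (z.1, Real.cos z.2) ∂((νw lam).prod (rho lam)) =
      ∫⁻ z, K (z.1 * Real.cos z.2, z.1 * Real.sin z.2) ∂((νw lam).prod (rho lam)) := by
    refine lintegral_congr_ae ?_
    have hpos : ∀ᵐ z ∂((νw lam).prod (rho lam)), 0 < z.1 := by
      have : ∀ᵐ t ∂(νw lam), 0 < t := by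
        unfold νw
        exact (withDensity_absolutelyContinuous _ _).ae_le (ae_restrict_mem measurableSet_Ioi)
      exact Measure.quasiMeasurePreserving_fst.ae this
    filter_upwards [hpos] with z hz
    have : (z.1 * Real.cos z.2) ^ 2 + (z.1 * Real.sin z.2) ^ 2 = z.1 ^ 2 := by
      rw [mul_pow, mul_pow, Real.sin_sq]; ring
    simp only [hK, this, Real.sqrt_sq hz.le]
    rw [mul_div_cancel_left₀ _ hz.ne']
  rw [e2, h2]
  have mp : MeasurePreserving (fun w : ℝ × ℝ => (x - w.1, w.2)) (volume.prod volume)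
      (volume.prod volume) :=
    (Measure.measurePreserving_sub_left volume x).prod (MeasurePreserving.id volume)
  have hw : Measurable ((Set.Ioi (0:ℝ)).indicator
        (fun v => ENNReal.ofReal (blam lam * clam lam * v ^ (2 * lam)))) :=
    Measurable.indicator (by fun_prop) measurableSet_Ioi
  exact mp.lintegral_comp (f := fun z : ℝ × ℝ => (Set.Ioi (0:ℝ)).indicator
        (fun v => ENNReal.ofReal (blam lam * clam lam * v ^ (2 * lam))) z.2 * K z)
        ((hw.comp measurable_snd).mul hKm)

lemma lintegral_μw {lam : ℝ} (H : ℝ → ℝ≥0∞) (hH : Measurable H) :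
    ∫⁻ x, H x ∂(μw lam) = ∫⁻ t, (H t + H (-t)) / 2 ∂(νw lam) := by
  have hm : Measurable fun x : ℝ => ENNReal.ofReal (blam lam / 2 * |x| ^ (2 * lam + 1)) * H x := by
    fun_prop
  have hpt : ∀ t ∈ Set.Ioi (0:ℝ), ENNReal.ofReal (blam lam * t ^ (2 * lam + 1)) *
      ((H t + H (-t)) / 2) = ENNReal.ofReal (blam lam / 2 * |t| ^ (2 * lam + 1)) * H t +
        ENNReal.ofReal (blam lam / 2 * |-t| ^ (2 * lam + 1)) * H (-t) := by
    intro t ht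
    rw [abs_neg, abs_of_pos ht, ← mul_add, ← mul_div_assoc, ENNReal.mul_div_right_comm]
    congr 1
    rw [div_mul_eq_mul_div, ENNReal.ofReal_div_of_pos (by norm_num)]
    simp
  rw [μw, νw, lintegral_withDensity_eq_lintegral_mul _ (by fun_prop) hH,
    lintegral_withDensity_eq_lintegral_mul _ (by fun_prop) (by fun_prop)]
  simp only [Pi.mul_apply]
  rw [setLIntegral_congr_fun measurableSet_Ioi hpt, lintegral_add_left hm,
    ← lintegral_add_compl _ (measurableSet_Ioi (a := (0:ℝ))), Set.compl_Ioi,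
    setLIntegral_congr (Iio_ae_eq_Iic (a := (0:ℝ))).symm]
  congr 1
  rw [← lintegral_indicator measurableSet_Iio, ← lintegral_indicator measurableSet_Ioi,
    ← lintegral_neg_eq_self]
  refine lintegral_congr fun t => ?_
  simp [Set.indicator]

/-- The fixed-`t` or fixed-`x` integrand. -/
def Qf (u v : ℝ → ℝ≥0∞) (x t φ : ℝ) : ℝ≥0∞ :=
  ENNReal.ofReal ((1 + Bf x t φ) / 2) * (u (Af x t φ) * v t) +
    ENNReal.ofReal ((1 - Bf x t φ) / 2) * (u (-Af x t φ) * v t)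

lemma half_add {b : ℝ} (hb : |b| ≤ 1) :
    ENNReal.ofReal ((1 + b) / 2) + ENNReal.ofReal ((1 - b) / 2) = 1 := by
  have := abs_le.1 hb
  rw [← ENNReal.ofReal_add (by linarith) (by linarith)]
  simp [← add_div]

lemma rho_half {lam : ℝ} (hlam : -(1/2 : ℝ) < lam) :
    ∫⁻ φ, ENNReal.ofReal ((1 + Real.cos φ) / 2) ∂(rho lam) = 1 / 2 ∧
    ∫⁻ φ, ENNReal.ofReal ((1 - Real.cos φ) / 2) ∂(rho lam) = 1 / 2 := by
  have h := rho_reflect lam (fun φ => ENNReal.ofReal ((1 + Real.cos φ) / 2)) (by fun_prop)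
  simp only [Real.cos_pi_sub, ← sub_eq_add_neg] at h
  have h2 : ∫⁻ φ, ENNReal.ofReal ((1 + Real.cos φ) / 2) ∂(rho lam) +
    ∫⁻ φ, ENNReal.ofReal ((1 - Real.cos φ) / 2) ∂(rho lam) = 1 := by
    rw [← lintegral_add_left (by fun_prop)]
    simp only [half_add (Real.abs_cos_le_one _)]
    simp [rho_univ hlam]
  rw [h, and_self]
  rw [h, ← two_mul] at h2
  rw [ENNReal.eq_div_iff (by simp) (by simp), h2]

/-- Marginal in `y` for fixed `x`. -/
lemma marg_snd {lam : ℝ} (hlam : -(1/2 : ℝ) < lam) (u : ℝ → ℝ≥0∞) (hu : Measurable u) (x : ℝ) :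
    ∫⁻ z, (ENNReal.ofReal ((1 + Bf x z.1 z.2) / 2) * u (Af x z.1 z.2) +
      ENNReal.ofReal ((1 - Bf x z.1 z.2) / 2) * u (-Af x z.1 z.2)) ∂((νw lam).prod (rho lam)) =
    ∫⁻ y, u y ∂(μw lam) := by
  rw [polar_key hlam (fun w => ENNReal.ofReal ((1 + w.2) / 2) * u w.1 +
      ENNReal.ofReal ((1 - w.2) / 2) * u (- w.1)) (by fun_prop) x,
    lintegral_prod _ (by fun_prop), lintegral_μw u hu]
  refine lintegral_congr fun t => ?_
  dsimp only
  rw [lintegral_add_left (by fun_prop), lintegral_mul_const _ (by fun_prop),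
    lintegral_mul_const _ (by fun_prop), (rho_half hlam).1, (rho_half hlam).2, ← mul_add,
    one_div, ← ENNReal.div_eq_inv_mul]

lemma Af_comm (x t φ : ℝ) : Af x t φ = Af t x φ := by
  unfold Af; congr 1; ring

lemma Af_neg (x t φ : ℝ) : Af (-x) t (π - φ) = Af x t φ := by
  unfold Af; rw [Real.cos_pi_sub]; congr 1; ring

lemma Bf_neg (x t φ : ℝ) : Bf (-x) t (π - φ) = - Bf x t φ := by
  unfold Bf; rw [Af_neg, Real.cos_pi_sub]; ring

/-- Integral in `x` for fixed `t`. -/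
lemma marg_x {lam : ℝ} (hlam : -(1/2 : ℝ) < lam) (u : ℝ → ℝ≥0∞) (hu : Measurable u) (t : ℝ) :
    ∫⁻ x, ∫⁻ φ, (ENNReal.ofReal ((1 + Bf x t φ) / 2) * u (Af x t φ) +
      ENNReal.ofReal ((1 - Bf x t φ) / 2) * u (-Af x t φ)) ∂(rho lam) ∂(μw lam) =
    ∫⁻ y, u y ∂(μw lam) := by
  set S : ℝ × ℝ → ℝ≥0∞ := fun w => ENNReal.ofReal ((1 + Bf w.1 t w.2) / 2) * u (Af w.1 t w.2) +
      ENNReal.ofReal ((1 - Bf w.1 t w.2) / 2) * u (-Af w.1 t w.2) with hS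
  have hSm : Measurable S := by fun_prop
  have hSm' : Measurable fun x => ∫⁻ φ, S (x, φ) ∂(rho lam) := hSm.lintegral_prod_right'
  change ∫⁻ x, ∫⁻ φ, S (x, φ) ∂(rho lam) ∂(μw lam) = _
  rw [lintegral_μw _ hSm']
  have e : ∀ x, (∫⁻ φ, S (x, φ) ∂(rho lam) + ∫⁻ φ, S (-x, φ) ∂(rho lam)) / 2 =
      ∫⁻ φ, (u (Af t x φ) + u (- Af t x φ)) / 2 ∂(rho lam) := by
    intro x
    rw [← rho_reflect lam (fun φ => S (-x, φ)) (by fun_prop), ← lintegral_add_left (by fun_prop),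
      ENNReal.div_eq_inv_mul, ← lintegral_const_mul _ (by fun_prop)]
    refine lintegral_congr fun φ => ?_
    simp only [hS, Af_neg, Bf_neg, sub_neg_eq_add, ← sub_eq_add_neg]
    rw [ENNReal.div_eq_inv_mul, Af_comm t x]
    congr 1
    have := half_add (Bf_abs_le x t φ)
    generalize ENNReal.ofReal ((1 + Bf x t φ) / 2) = a at *
    generalize ENNReal.ofReal ((1 - Bf x t φ) / 2) = b at *
    generalize u (Af x t φ) = c
    generalize u (-Af x t φ) = d
    calc a * c + b * d + (b * c + a * d) = (a + b) * (c + d) := by ring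
      _ = _ := by rw [this, one_mul]
  simp only [e]
  have h1 := polar_key hlam (fun w => (u w.1 + u (- w.1)) / 2) (by fun_prop) t
  rw [lintegral_prod _ (by fun_prop), lintegral_prod _ (by fun_prop)] at h1
  dsimp only at h1
  rw [h1, lintegral_μw u hu]
  simp [rho_univ hlam]

/-- The joint measure for fixed `x`. -/
def mm (lam x : ℝ) : Measure (ℝ × ℝ) :=
  (((νw lam).prod (rho lam)).withDensity
      fun z => ENNReal.ofReal ((1 + Bf x z.1 z.2) / 2)).map (fun z => (z.1, Af x z.1 z.2)) +
  (((νw lam).prod (rho lam)).withDensity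
      fun z => ENNReal.ofReal ((1 - Bf x z.1 z.2) / 2)).map (fun z => (z.1, -Af x z.1 z.2))

lemma lintegral_mm (lam x : ℝ) (H : ℝ × ℝ → ℝ≥0∞) (hH : Measurable H) :
    ∫⁻ z, H z ∂(mm lam x) = ∫⁻ z, (ENNReal.ofReal ((1 + Bf x z.1 z.2) / 2) * H (z.1, Af x z.1 z.2) +
      ENNReal.ofReal ((1 - Bf x z.1 z.2) / 2) * H (z.1, -Af x z.1 z.2)) ∂((νw lam).prod (rho lam)) := by
  rw [mm, lintegral_add_measure, lintegral_map hH (by fun_prop), lintegral_map hH (by fun_prop),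
    lintegral_withDensity_eq_lintegral_mul _ (by fun_prop) (by fun_prop),
    lintegral_withDensity_eq_lintegral_mul _ (by fun_prop) (by fun_prop), ← lintegral_add_left]
  · rfl
  · fun_prop

lemma mm_snd {lam : ℝ} (hlam : -(1/2 : ℝ) < lam) (x : ℝ) :
    (mm lam x).map Prod.snd = μw lam := by
  refine Measure.ext_of_lintegral _ fun u hu => ?_
  rw [lintegral_map hu measurable_snd, lintegral_mm _ _ _ (by fun_prop), marg_snd hlam u hu]

lemma mm_fst {lam : ℝ} (hlam : -(1/2 : ℝ) < lam) (x : ℝ) :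
    (mm lam x).map Prod.fst = νw lam := by
  refine Measure.ext_of_lintegral _ fun u hu => ?_
  rw [lintegral_map hu measurable_fst, lintegral_mm _ _ _ (by fun_prop)]
  simp only [← add_mul, half_add (Bf_abs_le _ _ _), one_mul]
  rw [lintegral_prod _ (by fun_prop)]
  simp [rho_univ hlam]

lemma mm_meas (lam : ℝ) (H : ℝ × ℝ → ℝ≥0∞) (hH : Measurable H) :
    Measurable fun x => ∫⁻ z, H z ∂(mm lam x) := by
  simp only [lintegral_mm lam _ H hH]
  exact Measurable.lintegral_prod_right' (f := fun w : ℝ × (ℝ × ℝ) =>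
    ENNReal.ofReal ((1 + Bf w.1 w.2.1 w.2.2) / 2) * H (w.2.1, Af w.1 w.2.1 w.2.2) +
      ENNReal.ofReal ((1 - Bf w.1 w.2.1 w.2.2) / 2) * H (w.2.1, -Af w.1 w.2.1 w.2.2)) (by fun_prop)

lemma mm_tot {lam : ℝ} (hlam : -(1/2 : ℝ) < lam) (u v : ℝ → ℝ≥0∞) (hu : Measurable u)
    (hv : Measurable v) :
    ∫⁻ x, ∫⁻ z, u z.2 * v z.1 ∂(mm lam x) ∂(μw lam) =
      (∫⁻ y, u y ∂(μw lam)) * ∫⁻ t, v t ∂(νw lam) := by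
  have e : ∀ x, ∫⁻ z, u z.2 * v z.1 ∂(mm lam x) = ∫⁻ t, (∫⁻ φ,
      (ENNReal.ofReal ((1 + Bf x t φ) / 2) * u (Af x t φ) +
      ENNReal.ofReal ((1 - Bf x t φ) / 2) * u (-Af x t φ)) ∂(rho lam)) * v t ∂(νw lam) := by
    intro x
    rw [lintegral_mm _ _ _ (by fun_prop), lintegral_prod _ (by fun_prop)]
    refine lintegral_congr fun t => ?_
    rw [← lintegral_mul_const _ (by fun_prop)]
    refine lintegral_congr fun φ => ?_
    ring
  set K : ℝ → ℝ → ℝ≥0∞ := fun x t => ∫⁻ φ,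
      (ENNReal.ofReal ((1 + Bf x t φ) / 2) * u (Af x t φ) +
      ENNReal.ofReal ((1 - Bf x t φ) / 2) * u (-Af x t φ)) ∂(rho lam) with hKdef
  have hK : Measurable (Function.uncurry K) :=
    Measurable.lintegral_prod_right' (f := fun w : (ℝ × ℝ) × ℝ =>
      ENNReal.ofReal ((1 + Bf w.1.1 w.1.2 w.2) / 2) * u (Af w.1.1 w.1.2 w.2) +
      ENNReal.ofReal ((1 - Bf w.1.1 w.1.2 w.2) / 2) * u (-Af w.1.1 w.1.2 w.2)) (by fun_prop)
  have hx : ∀ t, ∫⁻ x, K x t ∂(μw lam) = ∫⁻ y, u y ∂(μw lam) := fun t => marg_x hlam u hu t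
  have e' : ∀ x, ∫⁻ z, u z.2 * v z.1 ∂(mm lam x) = ∫⁻ t, K x t * v t ∂(νw lam) := e
  rw [lintegral_congr e']
  clear_value K
  have hKv : Measurable (Function.uncurry fun x t => K x t * v t) :=
    hK.mul (hv.comp measurable_snd)
  rw [lintegral_lintegral_swap hKv.aemeasurable, ← lintegral_const_mul _ hv]
  refine lintegral_congr fun t => ?_
  have hKt : Measurable fun x => K x t := hK.comp (measurable_id.prodMk measurable_const)
  rw [lintegral_mul_const _ hKt, hx]

lemma T_bound {lam : ℝ} (hlam : -(1/2 : ℝ) < lam) (f : ℝ → ℂ) (hf : Measurable f) (x t : ℝ) :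
    ‖T lam t f x‖ₑ ≤ ∫⁻ φ, (ENNReal.ofReal ((1 + Bf x t φ) / 2) * ‖f (Af x t φ)‖ₑ +
      ENNReal.ofReal ((1 - Bf x t φ) / 2) * ‖f (-Af x t φ)‖ₑ) ∂(rho lam) := by
  have hc := clam_pos hlam
  have hm : Measurable fun φ => (ENNReal.ofReal ((1 + Bf x t φ) / 2) * ‖f (Af x t φ)‖ₑ +
      ENNReal.ofReal ((1 - Bf x t φ) / 2) * ‖f (-Af x t φ)‖ₑ) := by fun_prop
  rw [rho, lintegral_withDensity_eq_lintegral_mul _ (by fun_prop) hm, T, enorm_mul]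
  refine (mul_le_mul_right (enorm_integral_le_lintegral_enorm _) _).trans ?_
  rw [← lintegral_const_mul' _ _ (by simp)]
  refine setLIntegral_mono' measurableSet_Ioo fun φ hφ => ?_
  have hs : 0 < Real.sin φ := Real.sin_pos_of_mem_Ioo hφ
  have hsp : 0 < Real.sin φ ^ (2 * lam) := by positivity
  have hB := abs_le.1 (Bf_abs_le x t φ)
  have e1 : ‖((clam lam / 2 : ℝ) : ℂ)‖ₑ = ENNReal.ofReal (clam lam / 2) := by
    rw [← ofReal_norm, Complex.norm_real, Real.norm_of_nonneg (by positivity)]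
  have e2 : ‖((Real.sin φ ^ (2 * lam) : ℝ) : ℂ)‖ₑ = ENNReal.ofReal (Real.sin φ ^ (2 * lam)) := by
    rw [← ofReal_norm, Complex.norm_real, Real.norm_of_nonneg (by positivity)]
  have e3 : ‖(1 + ((Bf x t φ : ℝ) : ℂ))‖ₑ = ENNReal.ofReal (1 + Bf x t φ) := by
    rw [← Complex.ofReal_one, ← Complex.ofReal_add, ← ofReal_norm, Complex.norm_real,
      Real.norm_of_nonneg (by linarith)]
  have e4 : ‖(1 - ((Bf x t φ : ℝ) : ℂ))‖ₑ = ENNReal.ofReal (1 - Bf x t φ) := by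
    rw [← Complex.ofReal_one, ← Complex.ofReal_sub, ← ofReal_norm, Complex.norm_real,
      Real.norm_of_nonneg (by linarith)]
  change _ * ‖(f (Af x t φ) * (1 + ((Bf x t φ : ℝ) : ℂ)) +
    f (-Af x t φ) * (1 - ((Bf x t φ : ℝ) : ℂ))) * ((Real.sin φ ^ (2 * lam) : ℝ) : ℂ)‖ₑ ≤ _
  rw [e1, enorm_mul, e2]
  refine (mul_le_mul_right (mul_le_mul_left (enorm_add_le _ _) _) _).trans (le_of_eq ?_)
  rw [enorm_mul, enorm_mul, e3, e4, Pi.mul_apply, ENNReal.ofReal_mul hc.le,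
    ENNReal.ofReal_div_of_pos (by norm_num), ENNReal.ofReal_div_of_pos (by norm_num),
    ENNReal.ofReal_div_of_pos (by norm_num)]
  simp only [div_eq_mul_inv]
  ring

/-- Young's inequality for the generalized convolution: let `λ > −1/2`,
`1 ≤ p, q ≤ ∞` with `1/p + 1/q ≥ 1`, and `1/r = 1/p + 1/q − 1`. For a Schwartz function `f` on
`ℝ` and (the restriction to `(0,∞)` of) an even Schwartz function `g`, the convolution
`(f ∗_λ g)(x) = ∫_0^∞ T^t f(x) g(t) dν_λ(t)` satisfies
`‖f ∗_λ g‖_{L^r(ℝ,dμ)} ≤ ‖f‖_{L^p(ℝ,dμ)} ‖g‖_{L^q((0,∞),dν_λ)}`. -/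
theorem stmt12 (lam : ℝ) (hlam : -(1/2 : ℝ) < lam)
    (p q r : ℝ≥0∞) (hp : 1 ≤ p) (hq : 1 ≤ q)
    (hpq : 1 ≤ p⁻¹ + q⁻¹) (hr : r⁻¹ = p⁻¹ + q⁻¹ - 1)
    (f g : SchwartzMap ℝ ℂ) (hgeven : ∀ x : ℝ, g (-x) = g x) :
    eLpNorm (fun x => ∫ t, T lam t f x * g t ∂(νw lam)) r (μw lam) ≤
      eLpNorm (⇑f) p (μw lam) * eLpNorm (⇑g) q (νw lam) := by
  refine young_abstract (μw lam) (νw lam) (mm lam) (mm_snd hlam) (mm_fst hlam) (mm_meas lam)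
    (fun u v hu hv => mm_tot hlam u v hu hv) p q r hp hq hpq hr f g _ f.continuous.measurable
    g.continuous.measurable fun x => ?_
  have hf : Measurable f := f.continuous.measurable
  have hg : Measurable g := g.continuous.measurable
  refine (enorm_integral_le_lintegral_enorm _).trans ?_
  rw [lintegral_mm _ _ _ (by fun_prop), lintegral_prod _ (by fun_prop)]
  refine lintegral_mono fun t => ?_
  rw [enorm_mul]
  refine (mul_le_mul_left (T_bound hlam f hf x t) _).trans (le_of_eq ?_)
  rw [← lintegral_mul_const _ (by fun_prop)]
  refine lintegral_congr fun φ => ?_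
  ring

end Dunkl1DStmt12
end
end

section
/- (Mass preservation for the one-dimensional generalized translation.) Let λ > −1/2 and t ∈ ℝ. For every Schwartz function f on ℝ one has ∫_ℝ T^t f(x) |x|^{2λ+1} dx = ∫_ℝ f(x) |x|^{2λ+1} dx. -/
open MeasureTheory Real
open scoped NNReal ENNReal

noncomputable section

namespace Dunkl1DStmt13

/-- `b_λ = (2^λ Γ(λ+1))⁻¹`. -/
def blam (lam : ℝ) : ℝ := ((2 : ℝ) ^ lam * Real.Gamma (lam + 1))⁻¹

/-- `c_λ = Γ(λ+1)/(√π Γ(λ+1/2))`. -/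
def clam (lam : ℝ) : ℝ := Real.Gamma (lam + 1) / (Real.sqrt Real.pi * Real.Gamma (lam + 1/2))

/-- The measure `dμ(x) = (b_λ/2)|x|^{2λ+1} dx` on `ℝ`. -/
def μw (lam : ℝ) : Measure ℝ :=
  volume.withDensity fun x => ENNReal.ofReal (blam lam / 2 * |x| ^ (2 * lam + 1))

/-- The measure `dν_λ(t) = b_λ t^{2λ+1} dt` on `(0,∞)`. -/
def νw (lam : ℝ) : Measure ℝ :=
  (volume.restrict (Set.Ioi 0)).withDensity fun t => ENNReal.ofReal (blam lam * t ^ (2 * lam + 1))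

/-- The one-dimensional Dunkl-type generalized translation operator
`T^t f(x) = (c_λ/2) ∫_0^π [f(A)(1+B) + f(−A)(1−B)] sin^{2λ}φ dφ`,
`A = √(x² + t² − 2xt cos φ)`, `B = (x − t cos φ)/A` (with `B = 0` when `A = 0`, which is Lean's
division convention). -/
def T (lam t : ℝ) (f : ℝ → ℂ) (x : ℝ) : ℂ :=
  ((clam lam / 2 : ℝ) : ℂ) *
    ∫ φ in Set.Ioo (0 : ℝ) Real.pi,
      ((f (Real.sqrt (x ^ 2 + t ^ 2 - 2 * x * t * Real.cos φ)) *
          (1 + (((x - t * Real.cos φ) /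
            Real.sqrt (x ^ 2 + t ^ 2 - 2 * x * t * Real.cos φ) : ℝ) : ℂ)) +
        f (-Real.sqrt (x ^ 2 + t ^ 2 - 2 * x * t * Real.cos φ)) *
          (1 - (((x - t * Real.cos φ) /
            Real.sqrt (x ^ 2 + t ^ 2 - 2 * x * t * Real.cos φ) : ℝ) : ℂ))) *
        ((Real.sin φ ^ (2 * lam) : ℝ) : ℂ))


lemma half_polar {E : Type*} [NormedAddCommGroup E] [NormedSpace ℝ E] (h : ℝ × ℝ → E) :
    ∫ p in (Set.univ : Set ℝ) ×ˢ Set.Ioi (0 : ℝ), h p =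
      ∫ p in Set.Ioi (0 : ℝ) ×ˢ Set.Ioo (0 : ℝ) π,
        p.1 • h (p.1 * Real.cos p.2, p.1 * Real.sin p.2) := by
  have hm : MeasurableSet ((Set.univ : Set ℝ) ×ˢ Set.Ioi (0 : ℝ)) :=
    MeasurableSet.univ.prod measurableSet_Ioi
  have hm2 : MeasurableSet (Set.Ioi (0 : ℝ) ×ˢ Set.Ioo (0 : ℝ) π) :=
    measurableSet_Ioi.prod measurableSet_Ioo
  have hm3 : MeasurableSet (Set.Ioi (0 : ℝ) ×ˢ Set.Ioo (-π) π) :=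
    measurableSet_Ioi.prod measurableSet_Ioo
  rw [← integral_indicator hm, ← integral_comp_polarCoord_symm, polarCoord_target,
    ← integral_indicator hm2, ← integral_indicator hm3]
  congr 1
  ext ⟨r, θ⟩
  simp only [polarCoord_symm_apply, Set.indicator_apply, Set.mem_prod, Set.mem_univ, true_and,
    Set.mem_Ioi, Set.mem_Ioo]
  by_cases hr : 0 < r
  · by_cases h1 : 0 < θ ∧ θ < π
    · have h2 : -π < θ ∧ θ < π := ⟨by linarith [Real.pi_pos], h1.2⟩
      have h3 : 0 < r * Real.sin θ := mul_pos hr (Real.sin_pos_of_pos_of_lt_pi h1.1 h1.2)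
      simp [hr, h1, h2, h3]
    · by_cases h2 : -π < θ ∧ θ < π
      · have h4 : θ ≤ 0 := by
          by_contra h5
          exact h1 ⟨not_le.mp h5, h2.2⟩
        have h3 : ¬ 0 < r * Real.sin θ := by
          have := Real.sin_nonpos_of_nonpos_of_neg_pi_le h4 h2.1.le
          nlinarith
        have h6 : ¬ 0 < θ := not_lt.mpr h4
        simp [hr, h6, h2, h3]
      · simp [h1, h2]
  · simp [hr]

lemma half_shift {E : Type*} [NormedAddCommGroup E] [NormedSpace ℝ E] (h : ℝ × ℝ → E) (t : ℝ) :
    ∫ p in (Set.univ : Set ℝ) ×ˢ Set.Ioi (0 : ℝ), h (p.1 - t, p.2) =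
      ∫ p in (Set.univ : Set ℝ) ×ˢ Set.Ioi (0 : ℝ), h p := by
  have hm : MeasurableSet ((Set.univ : Set ℝ) ×ˢ Set.Ioi (0 : ℝ)) :=
    MeasurableSet.univ.prod measurableSet_Ioi
  rw [← integral_indicator hm, ← integral_indicator hm,
    ← integral_sub_right_eq_self
      (((Set.univ : Set ℝ) ×ˢ Set.Ioi (0 : ℝ)).indicator fun p => h p) ((t, 0) : ℝ × ℝ)]
  congr 1
  ext ⟨u, v⟩
  simp [Set.indicator_apply]

/-- radial-in-shifted-coordinates integral -/
lemma shifted_polar (lam : ℝ) (t : ℝ) (F : ℝ → ℂ) :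
    ∫ p in Set.Ioi (0 : ℝ) ×ˢ Set.Ioo (0 : ℝ) π,
        F (Real.sqrt (p.1 ^ 2 + t ^ 2 - 2 * p.1 * t * Real.cos p.2)) *
          ((p.1 ^ (2 * lam + 1) : ℝ) : ℂ) * ((Real.sin p.2 ^ (2 * lam) : ℝ) : ℂ) =
      ∫ p in (Set.univ : Set ℝ) ×ˢ Set.Ioi (0 : ℝ),
        F (Real.sqrt (p.1 ^ 2 + p.2 ^ 2)) * ((p.2 ^ (2 * lam) : ℝ) : ℂ) := by
  rw [← half_shift _ t, half_polar]
  refine setIntegral_congr_fun (measurableSet_Ioi.prod measurableSet_Ioo) ?_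
  rintro ⟨r, θ⟩ ⟨hr, hθ⟩
  simp only [Set.mem_Ioi] at hr
  have hs := Real.sin_pos_of_pos_of_lt_pi hθ.1 hθ.2
  have e1 : r ^ 2 + t ^ 2 - 2 * r * t * Real.cos θ
      = (r * Real.cos θ - t) ^ 2 + (r * Real.sin θ) ^ 2 := by
    have := Real.sin_sq_add_cos_sq θ
    linear_combination (-r ^ 2) * this
  have e2 : r ^ (2 * lam + 1) = r * r ^ (2 * lam) := by
    rw [Real.rpow_add hr, Real.rpow_one, mul_comm]
  simp only [e1, e2, Real.mul_rpow hr.le hs.le, Complex.real_smul]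
  push_cast
  ring

lemma shifted_polar_eq (lam : ℝ) (t : ℝ) (F : ℝ → ℂ) :
    ∫ p in Set.Ioi (0 : ℝ) ×ˢ Set.Ioo (0 : ℝ) π,
        F (Real.sqrt (p.1 ^ 2 + t ^ 2 - 2 * p.1 * t * Real.cos p.2)) *
          ((p.1 ^ (2 * lam + 1) : ℝ) : ℂ) * ((Real.sin p.2 ^ (2 * lam) : ℝ) : ℂ) =
      (∫ r in Set.Ioi (0 : ℝ), F r * ((r ^ (2 * lam + 1) : ℝ) : ℂ)) *
        ∫ θ in Set.Ioo (0 : ℝ) π, ((Real.sin θ ^ (2 * lam) : ℝ) : ℂ) := by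
  rw [shifted_polar, ← shifted_polar lam 0, ← setIntegral_prod_mul, ← Measure.volume_eq_prod]
  refine setIntegral_congr_fun (measurableSet_Ioi.prod measurableSet_Ioo) ?_
  rintro ⟨r, θ⟩ ⟨hr, hθ⟩
  simp only [Set.mem_Ioi] at hr
  simp [Real.sqrt_sq hr.le]

lemma gamma_half (s : ℝ) (hs : -1 < s) :
    ∫ x in Set.Ioi (0 : ℝ), x ^ s * Real.exp (-x ^ (2 : ℝ)) = Real.Gamma ((s + 1) / 2) / 2 := by
  rw [integral_rpow_mul_exp_neg_rpow (by norm_num) hs]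
  ring

lemma sin_integral (lam : ℝ) (hlam : -(1/2 : ℝ) < lam) :
    clam lam * ∫ θ in Set.Ioo (0 : ℝ) π, Real.sin θ ^ (2 * lam) = 1 := by
  have h := shifted_polar_eq lam 0 (fun r => ((Real.exp (-r ^ (2 : ℝ)) : ℝ) : ℂ))
  rw [shifted_polar lam 0 (fun r => ((Real.exp (-r ^ (2 : ℝ)) : ℝ) : ℂ))] at h
  have h1 : ∫ p in (Set.univ : Set ℝ) ×ˢ Set.Ioi (0 : ℝ),
        ((Real.exp (-(Real.sqrt (p.1 ^ 2 + p.2 ^ 2)) ^ (2 : ℝ)) : ℝ) : ℂ)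
          * ((p.2 ^ (2 * lam) : ℝ) : ℂ)
      = ((∫ x : ℝ, Real.exp (-1 * x ^ 2)) *
        ∫ x in Set.Ioi (0 : ℝ), x ^ (2 * lam) * Real.exp (-x ^ (2 : ℝ)) : ℝ) := by
    rw [← setIntegral_univ (μ := volume) (f := fun x : ℝ => Real.exp (-1 * x ^ 2)),
      ← setIntegral_prod_mul, ← Measure.volume_eq_prod, ← integral_complex_ofReal]
    congr 1
    ext p
    rw [← Complex.ofReal_mul]
    congr 1
    simp only [Real.rpow_two]
    rw [Real.sq_sqrt (by positivity), neg_add, Real.exp_add]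
    ring_nf
  rw [h1] at h
  have h2 : ∫ r in Set.Ioi (0 : ℝ), ((Real.exp (-r ^ (2 : ℝ)) : ℝ) : ℂ) *
      ((r ^ (2 * lam + 1) : ℝ) : ℂ)
      = ((∫ x in Set.Ioi (0 : ℝ), x ^ (2 * lam + 1) * Real.exp (-x ^ (2 : ℝ)) : ℝ) : ℂ) := by
    rw [← integral_complex_ofReal]
    congr 1
    ext r
    push_cast
    ring
  rw [h2, integral_complex_ofReal, ← Complex.ofReal_mul, Complex.ofReal_inj, integral_gaussian,
    gamma_half _ (by linarith), gamma_half _ (by linarith)] at h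
  have g1 : 0 < Real.Gamma (lam + 1/2) := Real.Gamma_pos_of_pos (by linarith)
  have g2 : 0 < Real.Gamma (lam + 1) := Real.Gamma_pos_of_pos (by linarith)
  have e1 : (2 * lam + 1) / 2 = lam + 1/2 := by ring
  have e2 : (2 * lam + 1 + 1) / 2 = lam + 1 := by ring
  have hpi : 0 < Real.sqrt π := Real.sqrt_pos.mpr Real.pi_pos
  rw [e1, e2, div_one] at h
  unfold clam
  rw [div_mul_eq_mul_div, div_eq_one_iff_eq (by positivity)]
  linarith

lemma sin_integrable (lam : ℝ) (hlam : -(1/2 : ℝ) < lam) :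
    IntegrableOn (fun θ => Real.sin θ ^ (2 * lam)) (Set.Ioo (0 : ℝ) π) := by
  by_contra hn
  have h := sin_integral lam hlam
  rw [integral_undef hn] at h
  simp at h

lemma decay (f : SchwartzMap ℝ ℂ) (k : ℕ) : ∃ C : ℝ, 0 ≤ C ∧ ∀ y, (1 + |y|) ^ k * ‖f y‖ ≤ C := by
  refine ⟨_, ?_, fun y => by
    simpa using SchwartzMap.one_add_le_sup_seminorm_apply (𝕜 := ℝ) (m := (k, 0)) (k := k) (n := 0)
      le_rfl le_rfl f y⟩
  positivity

/-- the dominating function -/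
def dom (lam : ℝ) (k : ℕ) (x : ℝ) : ℝ := |x| ^ (2 * lam + 1) / (1 + |x|) ^ k

lemma dom_integrable (lam : ℝ) (hlam : -(1/2 : ℝ) < lam) (k : ℕ) (hk : 2 * lam + 2 < k) :
    Integrable (dom lam k) := by
  have h := integrable_one_add_norm (E := ℝ) (μ := volume) (r := k - (2 * lam + 1))
    (by simp; linarith)
  refine h.mono' ?_ ?_
  · unfold dom
    exact Measurable.aestronglyMeasurable (by fun_prop)
  · refine Filter.Eventually.of_forall fun x => ?_
    have hx : 0 ≤ |x| := abs_nonneg x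
    unfold dom
    rw [Real.norm_of_nonneg (by positivity), Real.norm_eq_abs, neg_sub,
      Real.rpow_sub (by positivity), Real.rpow_natCast]
    gcongr
    · linarith
    · linarith

lemma f_bound {f : ℝ → ℂ} {k : ℕ} {C t : ℝ} (hC : 0 ≤ C)
    (h : ∀ y, (1 + |y|) ^ k * ‖f y‖ ≤ C) (x y : ℝ) (hxy : |x| - |t| ≤ |y|) :
    ‖f y‖ ≤ C * (1 + |t|) ^ k / (1 + |x|) ^ k := by
  have hx : 0 ≤ |x| := abs_nonneg x
  have hy : 0 ≤ |y| := abs_nonneg y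
  have ht : 0 ≤ |t| := abs_nonneg t
  rw [le_div_iff₀ (by positivity)]
  have h1 : (1 + |x|) ^ k ≤ ((1 + |y|) * (1 + |t|)) ^ k := by
    gcongr
    nlinarith
  calc ‖f y‖ * (1 + |x|) ^ k ≤ ‖f y‖ * ((1 + |y|) * (1 + |t|)) ^ k := by gcongr
    _ = ((1 + |y|) ^ k * ‖f y‖) * (1 + |t|) ^ k := by rw [mul_pow]; ring
    _ ≤ C * (1 + |t|) ^ k := by gcongr; exact h y

/-- `A` -/
def AA (t x φ : ℝ) : ℝ := Real.sqrt (x ^ 2 + t ^ 2 - 2 * x * t * Real.cos φ)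

/-- `B` -/
def BB (t x φ : ℝ) : ℝ := (x - t * Real.cos φ) / AA t x φ

lemma AA_lower (t x φ : ℝ) : |x| - |t| ≤ AA t x φ := by
  apply Real.le_sqrt_of_sq_le
  have h : x * t * Real.cos φ ≤ |x| * |t| := by
    calc x * t * Real.cos φ ≤ |x * t * Real.cos φ| := le_abs_self _
      _ = |x| * |t| * |Real.cos φ| := by rw [abs_mul, abs_mul]
      _ ≤ |x| * |t| * 1 := by gcongr; exact Real.abs_cos_le_one φ
      _ = _ := mul_one _
  nlinarith [sq_abs x, sq_abs t]

lemma BB_le (t x φ : ℝ) : |BB t x φ| ≤ 1 := by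
  unfold BB
  rw [abs_div]
  apply div_le_one_of_le₀ _ (abs_nonneg _)
  rw [abs_of_nonneg (show 0 ≤ AA t x φ from Real.sqrt_nonneg _)]
  apply Real.abs_le_sqrt
  have := Real.sin_sq_add_cos_sq φ
  nlinarith [mul_self_nonneg (t * Real.sin φ)]

/-- the full integrand -/
def GG (lam t : ℝ) (f : ℝ → ℂ) (x φ : ℝ) : ℂ :=
  (f (AA t x φ) * (1 + (BB t x φ : ℂ)) + f (-AA t x φ) * (1 - (BB t x φ : ℂ))) *
    ((Real.sin φ ^ (2 * lam) : ℝ) : ℂ)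

lemma AA_meas (t : ℝ) : Measurable (fun p : ℝ × ℝ => AA t p.1 p.2) := by
  unfold AA; fun_prop

lemma BB_meas (t : ℝ) : Measurable (fun p : ℝ × ℝ => BB t p.1 p.2) := by
  unfold BB
  have := AA_meas t
  fun_prop

lemma GG_meas (lam t : ℝ) (f : ℝ → ℂ) (hf : Measurable f) :
    Measurable (fun p : ℝ × ℝ => GG lam t f p.1 p.2) := by
  unfold GG
  have := AA_meas t
  have := BB_meas t
  fun_prop

lemma GG_bound {lam t : ℝ} {f : ℝ → ℂ} {k : ℕ} {C : ℝ} (hC : 0 ≤ C)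
    (h : ∀ y, (1 + |y|) ^ k * ‖f y‖ ≤ C) (x φ : ℝ) (hφ : φ ∈ Set.Ioo 0 π) :
    ‖GG lam t f x φ‖ ≤ 4 * (C * (1 + |t|) ^ k / (1 + |x|) ^ k) * Real.sin φ ^ (2 * lam) := by
  have hs := Real.sin_pos_of_pos_of_lt_pi hφ.1 hφ.2
  have hA0 : 0 ≤ AA t x φ := Real.sqrt_nonneg _
  have hA := AA_lower t x φ
  set M := C * (1 + |t|) ^ k / (1 + |x|) ^ k with hM
  have b1 : ‖f (AA t x φ)‖ ≤ M := f_bound hC h x _ (by rwa [abs_of_nonneg hA0])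
  have b2 : ‖f (-AA t x φ)‖ ≤ M := f_bound hC h x _ (by rwa [abs_neg, abs_of_nonneg hA0])
  have hB : ‖(BB t x φ : ℂ)‖ ≤ 1 := by
    rw [Complex.norm_real]; exact BB_le t x φ
  have c1 : ‖1 + (BB t x φ : ℂ)‖ ≤ 2 := (norm_add_le _ _).trans (by rw [norm_one]; linarith)
  have c2 : ‖1 - (BB t x φ : ℂ)‖ ≤ 2 := (norm_sub_le _ _).trans (by rw [norm_one]; linarith)
  have hM0 : 0 ≤ M := (norm_nonneg _).trans b1
  unfold GG
  rw [norm_mul, Complex.norm_real, Real.norm_of_nonneg (Real.rpow_nonneg hs.le _)]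
  gcongr
  refine (norm_add_le _ _).trans ?_
  rw [norm_mul, norm_mul]
  have d1 := mul_le_mul b1 c1 (norm_nonneg _) hM0
  have d2 := mul_le_mul b2 c2 (norm_nonneg _) hM0
  linarith

lemma GG_integrable_inner (lam t : ℝ) (hlam : -(1/2 : ℝ) < lam) (f : SchwartzMap ℝ ℂ) (x : ℝ) :
    Integrable (GG lam t f x) (volume.restrict (Set.Ioo 0 π)) := by
  obtain ⟨C, hC, h⟩ := decay f 0
  refine Integrable.mono' ((sin_integrable lam hlam).const_mul
    (4 * (C * (1 + |t|) ^ 0 / (1 + |x|) ^ 0))) ?_ ?_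
  · exact ((GG_meas lam t f f.continuous.measurable).comp measurable_prodMk_left).aestronglyMeasurable
  · filter_upwards [ae_restrict_mem measurableSet_Ioo] with φ hφ
    exact GG_bound hC h x φ hφ

lemma GG_integrable (lam t : ℝ) (hlam : -(1/2 : ℝ) < lam) (f : SchwartzMap ℝ ℂ) :
    Integrable (fun p : ℝ × ℝ => GG lam t f p.1 p.2 * ((|p.1| ^ (2 * lam + 1) : ℝ) : ℂ))
      (volume.prod (volume.restrict (Set.Ioo 0 π))) := by
  obtain ⟨k, hk⟩ := exists_nat_gt (2 * lam + 2)
  obtain ⟨C, hC, h⟩ := decay f k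
  have hd := ((dom_integrable lam hlam k hk).const_mul (4 * (C * (1 + |t|) ^ k))).mul_prod
    (sin_integrable lam hlam)
  refine hd.mono' ?_ ?_
  · have := GG_meas lam t f f.continuous.measurable
    exact Measurable.aestronglyMeasurable (by fun_prop)
  · have hae : ∀ᵐ p : ℝ × ℝ ∂(volume.prod (volume.restrict (Set.Ioo 0 π))), p.2 ∈ Set.Ioo 0 π :=
      Measure.quasiMeasurePreserving_snd.ae (ae_restrict_mem measurableSet_Ioo)
    filter_upwards [hae] with p hp
    rw [norm_mul, Complex.norm_real, Real.norm_of_nonneg (by positivity)]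
    refine (mul_le_mul_of_nonneg_right (GG_bound hC h p.1 p.2 hp) (by positivity)).trans
      (le_of_eq ?_)
    unfold dom
    ring

lemma T_eq (lam t : ℝ) (f : ℝ → ℂ) (x : ℝ) :
    T lam t f x = ((clam lam / 2 : ℝ) : ℂ) * ∫ φ in Set.Ioo (0 : ℝ) π, GG lam t f x φ := rfl

lemma GG_symm (lam t : ℝ) (f : ℝ → ℂ) (x φ : ℝ) :
    GG lam t f x φ + GG lam t f (-x) (π - φ) =
      2 * ((f (AA t x φ) + f (-AA t x φ)) * ((Real.sin φ ^ (2 * lam) : ℝ) : ℂ)) := by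
  have hA : AA t (-x) (π - φ) = AA t x φ := by
    unfold AA; rw [Real.cos_pi_sub]; congr 1; ring
  have hB : BB t (-x) (π - φ) = -BB t x φ := by
    unfold BB; rw [hA, Real.cos_pi_sub]; ring
  unfold GG
  rw [hA, hB, Real.sin_pi_sub]
  push_cast
  ring

lemma refl_int (g : ℝ → ℂ) :
    ∫ φ in Set.Ioo (0 : ℝ) π, g (π - φ) = ∫ φ in Set.Ioo (0 : ℝ) π, g φ := by
  rw [← integral_Ioc_eq_integral_Ioo, ← integral_Ioc_eq_integral_Ioo,
    ← intervalIntegral.integral_of_le Real.pi_pos.le,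
    ← intervalIntegral.integral_of_le Real.pi_pos.le, intervalIntegral.integral_comp_sub_left]
  simp

lemma refl_integrable {g : ℝ → ℂ} (hg : IntegrableOn g (Set.Ioo 0 π)) :
    IntegrableOn (fun φ => g (π - φ)) (Set.Ioo 0 π) := by
  rw [← intervalIntegrable_iff_integrableOn_Ioo_of_le Real.pi_pos.le] at hg ⊢
  have := (hg.comp_sub_left π).symm
  simpa using this

lemma integral_split {g : ℝ → ℂ} (hg : Integrable g) :
    ∫ x, g x = ∫ x in Set.Ioi (0 : ℝ), (g x + g (-x)) := by
  have h2 : IntegrableOn (fun x => g (-x)) (Set.Ioi 0) := hg.comp_neg.integrableOn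
  rw [integral_add hg.integrableOn h2, integral_comp_neg_Ioi, neg_zero, add_comm,
    intervalIntegral.integral_Iic_add_Ioi hg.integrableOn hg.integrableOn]

lemma f_integrable (lam : ℝ) (hlam : -(1/2 : ℝ) < lam) (f : SchwartzMap ℝ ℂ) :
    Integrable (fun x : ℝ => f x * ((|x| ^ (2 * lam + 1) : ℝ) : ℂ)) := by
  obtain ⟨k, hk⟩ := exists_nat_gt (2 * lam + 2)
  obtain ⟨C, hC, h⟩ := decay f k
  refine ((dom_integrable lam hlam k hk).const_mul C).mono' ?_ ?_
  · have := f.continuous.measurable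
    exact Measurable.aestronglyMeasurable (by fun_prop)
  · refine Filter.Eventually.of_forall fun x => ?_
    rw [norm_mul, Complex.norm_real, Real.norm_of_nonneg (by positivity)]
    have := f_bound (t := 0) hC h x x (by simp)
    simp only [abs_zero, add_zero, one_pow, mul_one] at this
    refine (mul_le_mul_of_nonneg_right this (by positivity)).trans (le_of_eq ?_)
    unfold dom
    ring

/-- mass preservation for the generalized translation: for `λ > −1/2`,
`t ∈ ℝ` and every Schwartz function `f` on `ℝ`,
`∫_ℝ T^t f(x) |x|^{2λ+1} dx = ∫_ℝ f(x) |x|^{2λ+1} dx`. -/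
theorem stmt13 (lam : ℝ) (hlam : -(1/2 : ℝ) < lam) (t : ℝ) (f : SchwartzMap ℝ ℂ) :
    ∫ x : ℝ, T lam t f x * ((|x| ^ (2 * lam + 1) : ℝ) : ℂ) =
      ∫ x : ℝ, f x * ((|x| ^ (2 * lam + 1) : ℝ) : ℂ) := by
  have hG := GG_integrable lam t hlam f
  have hT : Integrable (fun x : ℝ => T lam t f x * ((|x| ^ (2 * lam + 1) : ℝ) : ℂ)) := by
    have := hG.integral_prod_left.const_mul ((clam lam / 2 : ℝ) : ℂ)
    refine this.congr (Filter.Eventually.of_forall fun x => ?_)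
    simp only [T_eq]
    rw [integral_mul_const]
    ring
  rw [integral_split hT, integral_split (f_integrable lam hlam f)]
  set K : ℝ × ℝ → ℂ := fun p => (fun y => f y + f (-y))
    (Real.sqrt (p.1 ^ 2 + t ^ 2 - 2 * p.1 * t * Real.cos p.2)) *
          ((p.1 ^ (2 * lam + 1) : ℝ) : ℂ) * ((Real.sin p.2 ^ (2 * lam) : ℝ) : ℂ) with hK
  -- the symmetrised integrand
  have hpt : ∀ x ∈ Set.Ioi (0 : ℝ), T lam t f x * ((|x| ^ (2 * lam + 1) : ℝ) : ℂ) +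
      T lam t f (-x) * ((|-x| ^ (2 * lam + 1) : ℝ) : ℂ) =
      (clam lam : ℂ) * ∫ φ in Set.Ioo (0 : ℝ) π, K (x, φ) := by
    intro x hx
    have i1 := GG_integrable_inner lam t hlam f x
    have i2 := refl_integrable (GG_integrable_inner lam t hlam f (-x))
    rw [abs_neg, abs_of_pos hx, ← add_mul, T_eq, T_eq, ← mul_add,
      ← refl_int (GG lam t f (-x)), ← integral_add i1 i2]
    simp only [GG_symm]
    rw [integral_const_mul]
    have : ∀ φ, K (x, φ) = ((f (AA t x φ) + f (-AA t x φ)) * ((Real.sin φ ^ (2 * lam) : ℝ) : ℂ))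
        * ((x ^ (2 * lam + 1) : ℝ) : ℂ) := by
      intro φ
      simp only [hK, AA]
      ring
    simp only [this]
    rw [integral_mul_const]
    push_cast
    ring
  rw [setIntegral_congr_fun measurableSet_Ioi hpt, integral_const_mul]
  have hKint : IntegrableOn K (Set.Ioi (0 : ℝ) ×ˢ Set.Ioo (0 : ℝ) π) (volume.prod volume) := by
    obtain ⟨k, hk⟩ := exists_nat_gt (2 * lam + 2)
    obtain ⟨C, hC, h⟩ := decay f k
    have hd := ((dom_integrable lam hlam k hk).integrableOn (s := Set.Ioi 0)).integrable.const_mul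
      (2 * (C * (1 + |t|) ^ k)) |>.mul_prod (sin_integrable lam hlam)
    rw [Measure.prod_restrict] at hd
    refine hd.mono' ?_ ?_
    · have := f.continuous.measurable
      exact Measurable.aestronglyMeasurable (by fun_prop)
    · filter_upwards [ae_restrict_mem (measurableSet_Ioi.prod measurableSet_Ioo)] with p hp
      obtain ⟨hp1, hp2⟩ := hp
      simp only [Set.mem_Ioi] at hp1
      have hs := Real.sin_pos_of_pos_of_lt_pi hp2.1 hp2.2
      have hA0 : 0 ≤ AA t p.1 p.2 := Real.sqrt_nonneg _
      have hA := AA_lower t p.1 p.2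
      have b1 := f_bound (t := t) hC h p.1 (AA t p.1 p.2) (by rwa [abs_of_nonneg hA0])
      have b2 := f_bound (t := t) hC h p.1 (-AA t p.1 p.2) (by rwa [abs_neg, abs_of_nonneg hA0])
      have b3 := (norm_add_le _ _).trans (add_le_add b1 b2)
      simp only [hK]
      rw [norm_mul, norm_mul, Complex.norm_real, Complex.norm_real,
        Real.norm_of_nonneg (by positivity), Real.norm_of_nonneg (by positivity)]
      refine (mul_le_mul_of_nonneg_right (mul_le_mul_of_nonneg_right b3 (by positivity))
        (by positivity)).trans (le_of_eq ?_)
      unfold dom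
      rw [abs_of_pos hp1]
      ring
  rw [← setIntegral_prod _ hKint, ← Measure.volume_eq_prod,
    shifted_polar_eq lam t (fun y => f y + f (-y)), integral_complex_ofReal]
  have hS : (clam lam : ℂ) * ((∫ θ in Set.Ioo (0 : ℝ) π, Real.sin θ ^ (2 * lam) : ℝ) : ℂ) = 1 := by
    rw [← Complex.ofReal_mul, sin_integral lam hlam, Complex.ofReal_one]
  rw [mul_left_comm, hS, mul_one]
  refine setIntegral_congr_fun measurableSet_Ioi fun x hx => ?_
  simp only [Set.mem_Ioi] at hx
  simp only [abs_neg, abs_of_pos hx]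
  ring

end Dunkl1DStmt13
end
end
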